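/- For every odd integer f0 ≥ 12, the pair (f0 + 1, ⌊(7/2)·f0 + 1⌋) belongs to E^6. Furthermore, for any integer f0 ≥ 7, if (f0 + 1, ⌊(7/2)·f0 + 1⌋) ∈ E^6, then (f0 + 7, ⌊(7/2)·(f0 + 6) + 1⌋) ∈ E^6. -/

import Mathlib

open Set

/-- A polytope: the convex hull of a finite set of points. -/
def IsPolytope {n : ℕ} (P : Set (Fin n → ℝ)) : Prop :=
  ∃ S : Finset (Fin n → ℝ), P = convexHull ℝ (S : Set (Fin n → ℝ))

/-- The affine dimension of a set: the rank of its vector span. -/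
noncomputable def adim {n : ℕ} (P : Set (Fin n → ℝ)) : ℕ :=
  Module.finrank ℝ (vectorSpan ℝ P)

/-- A `d`-polytope: a polytope whose affine hull has dimension `d`. -/
def IsDPolytope (d : ℕ) {n : ℕ} (P : Set (Fin n → ℝ)) : Prop :=
  IsPolytope P ∧ adim P = d

/-- An edge of `P`: a face (an extreme convex subset) of affine dimension 1. -/
def IsEdge {n : ℕ} (P E : Set (Fin n → ℝ)) : Prop :=
  IsExtreme ℝ P E ∧ Convex ℝ E ∧ adim E = 1

/-- `f₀ P`: the number of vertices (extreme points) of `P`. -/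
noncomputable def f₀ {n : ℕ} (P : Set (Fin n → ℝ)) : ℕ :=
  (Set.extremePoints ℝ P).ncard

/-- `f₁ P`: the number of edges of `P`. -/
noncomputable def f₁ {n : ℕ} (P : Set (Fin n → ℝ)) : ℕ :=
  {E : Set (Fin n → ℝ) | IsEdge P E}.ncard

/-- `E^d`: the set of `(f₀, f₁)` pairs realized by `d`-polytopes. -/
def fPairs (d : ℕ) : Set (ℕ × ℕ) :=
  {p | ∃ (n : ℕ) (P : Set (Fin n → ℝ)), IsDPolytope d P ∧ f₀ P = p.1 ∧ f₁ P = p.2}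

variable {n : ℕ}

/-- The vertex-edge graph of a convex set: two points are adjacent if they are distinct and span
an extreme segment. -/
def edgeGraph (P : Set (Fin n → ℝ)) : SimpleGraph (Fin n → ℝ) where
  Adj a b := a ≠ b ∧ IsExtreme ℝ P (segment ℝ a b)
  symm := ⟨fun _ _ h => ⟨h.1.symm, by rw [segment_symm]; exact h.2⟩⟩
  loopless := ⟨fun _ h => h.1 rfl⟩

theorem convexHull_extremePoints_of_finite {S : Set (Fin n → ℝ)} (hS : S.Finite) :
    convexHull ℝ ((convexHull ℝ S).extremePoints ℝ) = convexHull ℝ S := by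
  have h := closure_convexHull_extremePoints (hS.isCompact_convexHull ℝ) (convex_convexHull ℝ S)
  rwa [((hS.subset extremePoints_convexHull_subset).isClosed_convexHull ℝ).closure_eq] at h

theorem IsExtreme.eq_convexHull_inter {S E : Set (Fin n → ℝ)}
    (hE : IsExtreme ℝ (convexHull ℝ S) E) (hc : Convex ℝ E) : E = convexHull ℝ (E ∩ S) := by
  refine Subset.antisymm (fun x hx => ?_) (convexHull_min inter_subset_left hc)
  have hd : convexHull ℝ (S \ E) ⊆ convexHull ℝ S \ E :=
    convexHull_min (fun y hy => ⟨subset_convexHull ℝ S hy.1, hy.2⟩)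
      (hE.convex_sdiff (convex_convexHull ℝ S))
  have hxS := hE.subset hx
  rcases (S ∩ E).eq_empty_or_nonempty with h1 | h1
  · have : S \ E = S := by
      rw [sdiff_eq_self_iff_disjoint]; exact (disjoint_iff_inter_eq_empty.2 h1).symm
    rw [this] at hd
    exact absurd hx (hd hxS).2
  rcases (S \ E).eq_empty_or_nonempty with h2 | h2
  · rw [sdiff_eq_empty] at h2
    rwa [inter_eq_right.2 h2]
  rw [← inter_union_sdiff S E, convexHull_union h1 h2, mem_convexJoin] at hxS
  obtain ⟨y, hy, z, hz, hxyz⟩ := hxS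
  rw [inter_comm]
  rw [← insert_endpoints_openSegment] at hxyz
  rcases hxyz with rfl | rfl | h
  · exact hy
  · exact absurd hx (hd hz).2
  · exact absurd (hE.right_mem_of_mem_openSegment (convexHull_mono inter_subset_left hy)
      (hd hz).1 hx h) (hd hz).2

theorem isEdge_segment {P : Set (Fin n → ℝ)} {a b : Fin n → ℝ} (h : (edgeGraph P).Adj a b) :
    IsEdge P (segment ℝ a b) := by
  refine ⟨h.2, convex_segment a b, ?_⟩
  rw [adim, vectorSpan_segment, finrank_span_singleton]
  exact sub_ne_zero.2 h.1.symm

theorem openSegment_of_sub {a b x : Fin n → ℝ} {r : ℝ} (h0 : 0 < r) (h1 : r < 1)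
    (h : x - a = r • (b - a)) : x ∈ openSegment ℝ a b := by
  refine ⟨1 - r, r, by linarith, h0, by ring, ?_⟩
  rw [eq_add_of_sub_eq h]; module

/-- A point of `P` on the line through two extreme points of `P` lies between them. -/
theorem mem_segment_of_sub_eq_smul {P : Set (Fin n → ℝ)} {a b c : Fin n → ℝ}
    (ha : a ∈ P.extremePoints ℝ) (hb : b ∈ P.extremePoints ℝ) (hc : c ∈ P) {r : ℝ}
    (hr : c - a = r • (b - a)) : c ∈ segment ℝ a b := by
  have hce : c = a + r • (b - a) := by rw [← hr]; abel
  rcases lt_or_ge r 0 with h | h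
  · have : a ∈ openSegment ℝ c b := by
      rw [openSegment_symm]
      apply openSegment_of_sub (r := 1 / (1 - r)) (by apply div_pos <;> linarith)
        (by rw [div_lt_one] <;> linarith)
      have : (1 - r) ≠ 0 := by linarith
      rw [hce]
      have e : a + r • (b - a) - b = (1 - r) • (a - b) := by module
      rw [e, smul_smul, one_div_mul_cancel this, one_smul]
    rw [ha.2 hc hb.1 this]
    exact left_mem_segment ℝ _ _
  · rcases le_or_gt r 1 with h1 | h1
    · exact ⟨1 - r, r, by linarith, h, by ring, by rw [hce]; module⟩
    · have : b ∈ openSegment ℝ c a := by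
        rw [openSegment_symm]
        apply openSegment_of_sub (r := 1 / r) (by positivity)
          (by rw [div_lt_one] <;> linarith)
        rw [hr, smul_smul, one_div_mul_cancel (by linarith), one_smul]
      rw [hb.2 hc ha.1 this]
      exact right_mem_segment ℝ _ _

theorem IsEdge.exists_adj {S E : Set (Fin n → ℝ)} (hS : S.Finite)
    (hE : IsEdge (convexHull ℝ S) E) :
    ∃ a ∈ (convexHull ℝ S).extremePoints ℝ, ∃ b ∈ (convexHull ℝ S).extremePoints ℝ,
      (edgeGraph (convexHull ℝ S)).Adj a b ∧ E = segment ℝ a b := by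
  obtain ⟨hx, hc, hd⟩ := hE
  have hES := hx.eq_convexHull_inter hc
  have hEext : convexHull ℝ (E.extremePoints ℝ) = E := by
    conv_lhs => rw [hES]
    rw [convexHull_extremePoints_of_finite (hS.subset inter_subset_right), ← hES]
  have hnt : (E.extremePoints ℝ).Nontrivial := by
    by_contra h
    rw [not_nontrivial_iff] at h
    rw [adim, ← hEext, ← direction_affineSpan, affineSpan_convexHull, direction_affineSpan,
      vectorSpan_of_subsingleton ℝ h] at hd
    simp at hd
  obtain ⟨a, ha, b, hb, hab⟩ := hnt
  have hba : b - a ∈ vectorSpan ℝ E := vsub_mem_vectorSpan ℝ hb.1 ha.1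
  have hsp : ∀ c ∈ E.extremePoints ℝ, c ∈ segment ℝ a b := by
    intro c hcE
    have hca : c - a ∈ vectorSpan ℝ E := vsub_mem_vectorSpan ℝ hcE.1 ha.1
    obtain ⟨r, hr⟩ := (finrank_eq_one_iff_of_nonzero' (⟨b - a, hba⟩ : vectorSpan ℝ E)
      (by simpa [Subtype.ext_iff, sub_eq_zero] using hab.symm)).1 hd ⟨c - a, hca⟩
    exact mem_segment_of_sub_eq_smul ha hb hcE.1 (congrArg Subtype.val hr).symm
  have hseg : E = segment ℝ a b := by
    apply Subset.antisymm
    · rw [← hEext]; exact convexHull_min hsp (convex_segment a b)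
    · exact hc.segment_subset ha.1 hb.1
  exact ⟨a, hx.extremePoints_subset_extremePoints ha, b, hx.extremePoints_subset_extremePoints hb,
    ⟨hab, hseg ▸ hx⟩, hseg⟩

theorem mem_segment_extremePoints {P : Set (Fin n → ℝ)} {a b c : Fin n → ℝ}
    (ha : a ∈ P) (hb : b ∈ P) (hc : c ∈ P.extremePoints ℝ) (h : c ∈ segment ℝ a b) :
    c = a ∨ c = b := by
  rcases (mem_extremePoints_iff_forall_segment.1 hc).2 a ha b hb h with h | h
  exacts [.inl h.symm, .inr h.symm]

/-- If a linear functional attains its minimum over the points of `W` exactly at `a` and `b`, then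
the segment from `a` to `b` is an extreme subset of the convex hull of `W`. -/
theorem isExtreme_segment_of_le {W : Set (Fin n → ℝ)} (f : (Fin n → ℝ) →ₗ[ℝ] ℝ) {m : ℝ}
    {v a b : Fin n → ℝ} (ha : a ∈ W) (hb : b ∈ W) (hfa : f (a - v) = m) (hfb : f (b - v) = m)
    (hle : ∀ x ∈ W, m < f (x - v) ∨ x = a ∨ x = b) :
    IsExtreme ℝ (convexHull ℝ W) (segment ℝ a b) := by
  have hmin : ∀ x ∈ convexHull ℝ W, m ≤ f (x - v) := by
    have : convexHull ℝ W ⊆ {x | m + f v ≤ f x} := by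
      refine convexHull_min (fun x hx => ?_) (convex_halfSpace_ge f.isLinear _)
      have : m ≤ f (x - v) := by
        rcases hle x hx with h | rfl | rfl
        exacts [h.le, hfa.ge, hfb.ge]
      rw [map_sub] at this
      exact (by linarith : m + f v ≤ f x)
    intro x hx
    have h : m + f v ≤ f x := this hx
    rw [map_sub]; linarith
  have hF : IsExtreme ℝ (convexHull ℝ W) (convexHull ℝ W ∩ {x | f x = m + f v}) := by
    refine ⟨inter_subset_left, fun x hx y hy z hz hzxy => ⟨hx, ?_⟩⟩
    obtain ⟨α, β, hα, hβ, hαβ, rfl⟩ := hzxy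
    have h1 := hmin x hx
    have h2 := hmin y hy
    have h3 : f (α • x + β • y) = m + f v := hz.2
    rw [map_sub] at h1 h2
    rw [map_add, map_smul, map_smul, smul_eq_mul, smul_eq_mul] at h3
    change f x = m + f v
    obtain rfl : β = 1 - α := by linarith
    nlinarith
  have hFc : Convex ℝ (convexHull ℝ W ∩ {x | f x = m + f v}) :=
    (convex_convexHull ℝ W).inter (convex_hyperplane f.isLinear _)
  have hmem : ∀ x ∈ W, f (x - v) = m → x ∈ convexHull ℝ W ∩ {x | f x = m + f v} := by
    intro x hx h
    rw [map_sub] at h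
    exact ⟨subset_convexHull ℝ W hx, by change f x = _; linarith⟩
  convert! hF using 1
  apply Subset.antisymm
  · exact hFc.segment_subset (hmem a ha hfa) (hmem b hb hfb)
  · rw [hF.eq_convexHull_inter hFc, ← convexHull_pair]
    refine convexHull_mono ?_
    rintro x ⟨⟨-, hx⟩, hxW⟩
    have hx' : f x = m + f v := hx
    rcases hle x hxW with h | h
    · rw [map_sub] at h; linarith
    · exact h

theorem left_mem_extremePoints_of_isExtreme_segment {P : Set (Fin n → ℝ)} {a b : Fin n → ℝ}
    (h : IsExtreme ℝ P (segment ℝ a b)) : a ∈ P.extremePoints ℝ := by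
  apply h.extremePoints_subset_extremePoints
  refine ⟨left_mem_segment ℝ _ _, ?_⟩
  rw [segment_eq_image']
  rintro _ ⟨r, hr, rfl⟩ _ ⟨s, hs, rfl⟩ ⟨α, β, hα, hβ, hαβ, he⟩
  have h0 : (α * r + β * s) • (b - a) = 0 := by
    have : α • (a + r • (b - a)) + β • (a + s • (b - a)) =
        a + (α * r + β * s) • (b - a) := by
      rw [show β = 1 - α by linarith]; module
    rw [this] at he
    simpa using he
  change a + r • (b - a) = a
  rcases smul_eq_zero.1 h0 with h0 | h0
  · have h1 := mul_nonneg hα.le hr.1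
    have h2 := mul_nonneg hβ.le hs.1
    have h3 : α * r = 0 := by linarith
    rw [(mul_eq_zero.1 h3).resolve_left hα.ne']; simp
  · rw [h0]; simp

/-- An extreme set meeting the convex hull of `T` contains a point of `T`. -/
theorem IsExtreme.exists_mem_of_mem_convexHull {P E T : Set (Fin n → ℝ)} (hP : Convex ℝ P)
    (hE : IsExtreme ℝ P E) (hT : T ⊆ P) {x : Fin n → ℝ} (hx : x ∈ E) (hxT : x ∈ convexHull ℝ T) :
    ∃ y ∈ T, y ∈ E := by
  by_contra! h
  have hsub : convexHull ℝ T ⊆ P \ E :=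
    convexHull_min (fun y hy => ⟨hT hy, h y hy⟩) (hE.convex_sdiff hP)
  exact (hsub hxT).2 hx

open Classical in
theorem f_vector_of_parametrization {ι : Type*} [Fintype ι] {P : Set (Fin n → ℝ)}
    {pt : ι → Fin n → ℝ} (hinj : Function.Injective pt) (hP : P = convexHull ℝ (range pt))
    (hext : ∀ i, pt i ∈ P.extremePoints ℝ) :
    f₀ P = Fintype.card ι ∧
      2 * f₁ P = ∑ i, ∑ j, if (edgeGraph P).Adj (pt i) (pt j) then 1 else 0 := by
  have hE : P.extremePoints ℝ = range pt := by
    apply Subset.antisymm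
    · rw [hP]; exact extremePoints_convexHull_subset
    · rintro _ ⟨i, rfl⟩; exact hext i
  constructor
  · rw [f₀, hE, ← Set.image_univ, Set.ncard_image_of_injective _ hinj, Set.ncard_univ,
      Nat.card_eq_fintype_card]
  set G : SimpleGraph ι := (edgeGraph P).comap pt with hG
  let F : Sym2 ι → Set (Fin n → ℝ) := Sym2.lift ⟨fun i j => segment ℝ (pt i) (pt j),
    fun i j => segment_symm ℝ _ _⟩
  have himg : {E | IsEdge P E} = F '' G.edgeSet := by
    ext E
    constructor
    · intro h
      rw [mem_ofPred_eq, hP] at h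
      obtain ⟨a, ha, b, hb, hab, rfl⟩ := h.exists_adj (finite_range pt)
      rw [← hP] at ha hb hab
      rw [hE] at ha hb
      obtain ⟨i, rfl⟩ := ha
      obtain ⟨j, rfl⟩ := hb
      exact ⟨s(i, j), hab, rfl⟩
    · rintro ⟨e, he, rfl⟩
      induction e with | _ i j => exact isEdge_segment he
  have hFinj : InjOn F G.edgeSet := by
    intro e he e' he' h
    induction e with | _ i j
    induction e' with | _ k l
    change segment ℝ (pt i) (pt j) = segment ℝ (pt k) (pt l) at h
    have key : ∀ m i j, pt m ∈ segment ℝ (pt i) (pt j) → m = i ∨ m = j := fun m i j hm =>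
      (mem_segment_extremePoints (hext i).1 (hext j).1 (hext m) hm).imp
        (fun h => hinj h) (fun h => hinj h)
    have h1 := key i k l (h ▸ left_mem_segment ℝ _ _)
    have h2 := key j k l (h ▸ right_mem_segment ℝ _ _)
    have hij : i ≠ j := SimpleGraph.Adj.ne (G := G) he
    rw [Sym2.eq_iff]
    grind
  rw [f₁, himg, hFinj.ncard_image, ← SimpleGraph.coe_edgeFinset, Set.ncard_coe_finset,
    ← SimpleGraph.sum_degrees_eq_twice_card_edges]
  refine Finset.sum_congr rfl fun i _ => ?_
  rw [← SimpleGraph.card_neighborFinset_eq_degree, Finset.sum_boole, Nat.cast_id]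
  congr 1
  ext j
  simp [hG]

theorem exists_lt_of_mem_extremePoints {S : Set (Fin n → ℝ)} (hS : S.Finite) {v : Fin n → ℝ}
    (hv : v ∈ (convexHull ℝ S).extremePoints ℝ) :
    ∃ l : (Fin n → ℝ) →ₗ[ℝ] ℝ,
      ∀ w ∈ (convexHull ℝ S).extremePoints ℝ \ {v}, 0 < l (w - v) := by
  set V := (convexHull ℝ S).extremePoints ℝ with hV
  have hVf : (V \ {v}).Finite := (hS.subset extremePoints_convexHull_subset).subset sdiff_subset
  have hsub : convexHull ℝ (V \ {v}) ⊆ convexHull ℝ S \ {v} :=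
    convexHull_min (fun y hy => ⟨hy.1.1, hy.2⟩)
      ((convex_convexHull ℝ S).mem_extremePoints_iff_convex_sdiff.1 hv).2
  obtain ⟨f, u, hfu, hf⟩ := geometric_hahn_banach_point_closed (convex_convexHull ℝ (V \ {v}))
    (hVf.isClosed_convexHull ℝ) (fun h => (hsub h).2 rfl)
  refine ⟨f, fun w hw => ?_⟩
  have := hf w (subset_convexHull ℝ _ hw)
  simp only [ContinuousLinearMap.coe_coe, map_sub]
  linarith

/-- The edge directions at a vertex generate the tangent cone of the polytope there. -/
theorem sub_mem_of_forall_adj {S : Set (Fin n → ℝ)} (hS : S.Finite) {v : Fin n → ℝ}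
    (hv : v ∈ (convexHull ℝ S).extremePoints ℝ) (C : PointedCone ℝ (Fin n → ℝ))
    (hC : ∀ w ∈ (convexHull ℝ S).extremePoints ℝ, (edgeGraph (convexHull ℝ S)).Adj v w →
      w - v ∈ C) {x : Fin n → ℝ} (hx : x ∈ convexHull ℝ S) : x - v ∈ C := by
  obtain ⟨l, hl⟩ := exists_lt_of_mem_extremePoints hS hv
  set P := convexHull ℝ S with hP
  set V := P.extremePoints ℝ with hV
  have hVf : V.Finite := hS.subset extremePoints_convexHull_subset
  have hPV : convexHull ℝ V = P := convexHull_extremePoints_of_finite hS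
  let g : (Fin n → ℝ) → (Fin n → ℝ) := fun w => (l (w - v))⁻¹ • (w - v)
  set K := convexHull ℝ (g '' (V \ {v})) with hK
  have hKf : (g '' (V \ {v})).Finite := (hVf.subset sdiff_subset).image g
  have hg1 : ∀ w ∈ V \ {v}, l (g w) = 1 := fun w hw => by
    simp only [g, map_smul, smul_eq_mul]
    exact inv_mul_cancel₀ (hl w hw).ne'
  have hK1 : ∀ k ∈ K, l k = 1 := by
    have : K ⊆ {k | l k = 1} := by
      refine convexHull_min ?_ (convex_hyperplane l.isLinear 1)
      rintro _ ⟨w, hw, rfl⟩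
      exact hg1 w hw
    exact this
  have hgw : ∀ w ∈ V \ {v}, w - v = l (w - v) • g w := fun w hw => by
    simp only [g]
    rw [smul_smul, mul_inv_cancel₀ (hl w hw).ne', one_smul]
  have hray : ∀ a ∈ P, a ≠ v → 0 < l (a - v) ∧ ∃ k ∈ K, a - v = l (a - v) • k := by
    by_cases hne : (V \ {v}).Nonempty
    · obtain ⟨w₀, hw₀⟩ := hne
      have hconv : Convex ℝ {a : Fin n → ℝ | ∃ r : ℝ, 0 ≤ r ∧ ∃ k ∈ K, a - v = r • k} := by
        rintro a ⟨r, hr, k, hk, hak⟩ b ⟨s, hs, m, hm, hbm⟩ α β hα hβ hαβ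
        have e : α • a + β • b - v = (α * r) • k + (β * s) • m := by
          rw [mul_smul, mul_smul, ← hak, ← hbm, smul_sub, smul_sub]
          have : v = α • v + β • v := by rw [← add_smul, hαβ, one_smul]
          nth_rewrite 1 [this]; abel
        have h1 : 0 ≤ α * r := mul_nonneg hα hr
        have h2 : 0 ≤ β * s := mul_nonneg hβ hs
        rcases (add_nonneg h1 h2).eq_or_lt with h | h
        · refine ⟨0, le_rfl, k, hk, ?_⟩
          rw [e, show α * r = 0 by linarith, show β * s = 0 by linarith]; simp
        · refine ⟨α * r + β * s, h.le,
            (α * r / (α * r + β * s)) • k + (β * s / (α * r + β * s)) • m,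
            convex_convexHull ℝ _ hk hm (by positivity) (by positivity)
              (by rw [← add_div, div_self h.ne']), ?_⟩
          rw [e, smul_add, smul_smul, smul_smul, mul_div_cancel₀ _ h.ne',
            mul_div_cancel₀ _ h.ne']
      have hVc : V ⊆ {a : Fin n → ℝ | ∃ r : ℝ, 0 ≤ r ∧ ∃ k ∈ K, a - v = r • k} := by
        intro w hw
        by_cases hwv : w = v
        · exact ⟨0, le_rfl, g w₀, subset_convexHull ℝ _ ⟨w₀, hw₀, rfl⟩, by simp [hwv]⟩
        · exact ⟨l (w - v), (hl w ⟨hw, hwv⟩).le, g w, subset_convexHull ℝ _ ⟨w, ⟨hw, hwv⟩, rfl⟩,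
            hgw w ⟨hw, hwv⟩⟩
      intro a ha hav
      rw [← hPV] at ha
      obtain ⟨r, hr, k, hk, hak⟩ := convexHull_min hVc hconv ha
      have hlr : l (a - v) = r := by rw [hak, map_smul, hK1 k hk, smul_eq_mul, mul_one]
      rw [hlr]
      refine ⟨hr.lt_of_ne fun h => hav ?_, k, hk, hak⟩
      rw [← h, zero_smul] at hak
      exact sub_eq_zero.1 hak
    · intro a ha hav
      have hVs : V ⊆ {v} := by rwa [not_nonempty_iff_eq_empty, sdiff_eq_empty] at hne
      rw [← hPV] at ha
      exact absurd (convexHull_min hVs (convex_singleton v) ha) hav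
  have hadj : ∀ w ∈ V \ {v}, g w ∈ K.extremePoints ℝ → (edgeGraph P).Adj v w := by
    intro w hw hgext
    have hd := hl w hw
    set d := l (w - v) with hdd
    have hwd : w - v = d • g w := hgw w hw
    refine ⟨fun h => hw.2 h.symm, (convex_convexHull ℝ S).segment_subset hv.1 hw.1.1, ?_⟩
    intro a ha b hb x hxs hxo
    by_cases hav : a = v
    · rw [hav]; exact left_mem_segment ℝ _ _
    obtain ⟨hr, k, hk, hak⟩ := hray a ha hav
    set r := l (a - v) with hrdef
    obtain ⟨θ, hθ, hxθ⟩ : ∃ θ : ℝ, 0 ≤ θ ∧ x - v = θ • g w := by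
      obtain ⟨p, q, hp, hq, hpq, rfl⟩ := hxs
      refine ⟨q * d, by positivity, ?_⟩
      rw [mul_smul, ← hwd, eq_sub_iff_add_eq.2 hpq]; module
    obtain ⟨α, β, hα, hβ, hαβ, hx'⟩ := hxo
    have hxe : x - v = α • (a - v) + β • (b - v) := by
      rw [← hx', show β = 1 - α by linarith]; module
    have hkg : k = g w := by
      by_cases hbv : b = v
      · have h1 : θ • g w = (α * r) • k := by
          rw [← hxθ, hxe, hbv, sub_self, smul_zero, add_zero, hak, smul_smul]
        have h2 : θ = α * r := by
          have := congrArg l h1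
          simpa [hg1 w hw, hK1 k hk] using this
        have h3 : θ ≠ 0 := by rw [h2]; positivity
        rw [← h2] at h1
        exact (smul_right_injective _ h3 h1).symm
      · obtain ⟨hs, m, hm, hbm⟩ := hray b hb hbv
        set s := l (b - v) with hsdef
        have h1 : θ • g w = (α * r) • k + (β * s) • m := by
          rw [← hxθ, hxe, hak, hbm, smul_smul, smul_smul]
        have h2 : θ = α * r + β * s := by
          have := congrArg l h1
          simpa [hg1 w hw, hK1 k hk, hK1 m hm] using this
        have h3 : 0 < θ := by rw [h2]; positivity
        refine hgext.2 hk hm ⟨α * r / θ, β * s / θ, by positivity, by positivity, ?_, ?_⟩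
        · rw [← add_div, ← h2, div_self h3.ne']
        · rw [div_eq_inv_mul, div_eq_inv_mul, mul_smul, mul_smul _ _ m, ← smul_add, ← h1, smul_smul,
            inv_mul_cancel₀ h3.ne', one_smul]
    rw [hkg] at hak
    have hae : a - v = (r / d) • (w - v) := by
      rw [hwd, smul_smul, div_mul_cancel₀ _ hd.ne', hak]
    rcases le_or_gt (r / d) 1 with h1 | h1
    · refine ⟨1 - r / d, r / d, by linarith, by positivity, by ring, ?_⟩
      rw [eq_add_of_sub_eq hae]; module
    · exfalso
      have h2 : w ∈ openSegment ℝ v a := by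
        refine openSegment_of_sub (r := (r / d)⁻¹) (by positivity) (inv_lt_one_of_one_lt₀ h1) ?_
        rw [hae, smul_smul, inv_mul_cancel₀ (by positivity), one_smul]
      exact hw.2 (hw.1.2 hv.1 ha h2).symm
  have hCconv : Convex ℝ (C : Set (Fin n → ℝ)) := C.convex
  have hKC : K ⊆ C := by
    rw [hK, ← convexHull_extremePoints_of_finite hKf]
    refine convexHull_min (fun k hk => ?_) hCconv
    obtain ⟨w, hw, rfl⟩ := extremePoints_convexHull_subset hk
    exact C.smul_mem (inv_nonneg.2 (hl w hw).le)
      (hC w hw.1 (hadj w hw hk))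
  by_cases hxv : x = v
  · rw [hxv, sub_self]; exact C.zero_mem
  · obtain ⟨hr, k, hk, hxk⟩ := hray x hx hxv
    rw [hxk]
    exact C.smul_mem hr.le (hKC hk)

theorem vectorSpan_eq_span_neighbors {S : Set (Fin n → ℝ)} (hS : S.Finite) {v : Fin n → ℝ}
    (hv : v ∈ (convexHull ℝ S).extremePoints ℝ) :
    vectorSpan ℝ (convexHull ℝ S) = Submodule.span ℝ ((fun w => w - v) ''
      {w ∈ (convexHull ℝ S).extremePoints ℝ | (edgeGraph (convexHull ℝ S)).Adj v w}) := by
  apply le_antisymm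
  · rw [vectorSpan_eq_span_vsub_set_right ℝ hv.1, Submodule.span_le]
    rintro _ ⟨x, hx, rfl⟩
    refine sub_mem_of_forall_adj hS hv (Submodule.restrictScalars _ (Submodule.span ℝ _))
      (fun w hw hvw => ?_) hx
    exact Submodule.subset_span ⟨w, ⟨hw, hvw⟩, rfl⟩
  · rw [Submodule.span_le]
    rintro _ ⟨w, hw, rfl⟩
    exact vsub_mem_vectorSpan ℝ hw.1.1 hv.1

open Classical in
/-- A `d`-polytope whose average degree is less than `d + 1` has a simple vertex. -/
theorem exists_simple_vertex {d : ℕ} {S : Set (Fin n → ℝ)} (hS : S.Finite)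
    (hd : adim (convexHull ℝ S) = d)
    (hlt : 2 * f₁ (convexHull ℝ S) < (d + 1) * f₀ (convexHull ℝ S)) :
    ∃ v ∈ (convexHull ℝ S).extremePoints ℝ, ∃ w : Fin d → Fin n → ℝ,
      (∀ u, (∃ i, w i = u) ↔
        u ∈ (convexHull ℝ S).extremePoints ℝ ∧ (edgeGraph (convexHull ℝ S)).Adj v u) ∧
      LinearIndependent ℝ (fun i => w i - v) ∧ Function.Injective w := by
  set P := convexHull ℝ S with hP
  have hVf : (P.extremePoints ℝ).Finite := hS.subset extremePoints_convexHull_subset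
  have : Fintype (P.extremePoints ℝ) := hVf.fintype
  obtain ⟨h0, h1⟩ := f_vector_of_parametrization (P := P)
    (pt := ((↑) : P.extremePoints ℝ → Fin n → ℝ)) Subtype.val_injective
    (by rw [Subtype.range_coe]; exact (convexHull_extremePoints_of_finite hS).symm)
    (fun i => i.2)
  rw [h0, h1] at hlt
  obtain ⟨v, hv⟩ : ∃ v : P.extremePoints ℝ,
      (∑ u : P.extremePoints ℝ, if (edgeGraph P).Adj v u then 1 else 0) < d + 1 := by
    by_contra! h
    have := Finset.card_nsmul_le_sum Finset.univ _ _ (fun i _ => h i)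
    rw [Finset.card_univ, smul_eq_mul, mul_comm] at this
    exact absurd hlt (not_lt.2 this)
  let N : Finset (P.extremePoints ℝ) :=
    Finset.univ.filter fun u : P.extremePoints ℝ => (edgeGraph P).Adj v u
  have hN : N.card ≤ d := by
    rw [Finset.sum_boole, Nat.cast_id] at hv
    exact Nat.lt_succ_iff.1 hv
  let b : N → Fin n → ℝ := fun u => (u : Fin n → ℝ) - v
  have hspan : vectorSpan ℝ P = Submodule.span ℝ (range b) := by
    refine (vectorSpan_eq_span_neighbors hS v.2).trans ?_
    congr 1
    ext x
    constructor
    · rintro ⟨w, ⟨hw, hvw⟩, rfl⟩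
      exact ⟨⟨⟨w, hw⟩, by simpa [N] using hvw⟩, rfl⟩
    · rintro ⟨⟨w, hw⟩, rfl⟩
      exact ⟨w, ⟨w.2, by simpa [N] using hw⟩, rfl⟩
  have hfr : (range b).finrank ℝ = d := by
    rw [Set.finrank, ← hspan]; exact hd
  have hcard : Fintype.card N = d := by
    apply le_antisymm
    · simpa using hN
    · rw [← hfr]; exact finrank_range_le_card b
  have hli : LinearIndependent ℝ b := by
    rw [linearIndependent_iff_card_eq_finrank_span, hcard, hfr]
  let e : Fin d ≃ N := (Fintype.equivFinOfCardEq hcard).symm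
  refine ⟨v, v.2, fun i => (e i : Fin n → ℝ), fun u => ⟨?_, ?_⟩, hli.comp e e.injective, ?_⟩
  · rintro ⟨i, rfl⟩
    exact ⟨(e i).1.2, (Finset.mem_filter.1 (e i).2).2⟩
  · rintro ⟨hu, hvu⟩
    exact ⟨e.symm ⟨⟨u, hu⟩, by simpa [N] using hvu⟩, by simp⟩
  · exact Subtype.val_injective.comp (Subtype.val_injective.comp e.injective)

/-- A simple vertex `v` of `P` with its neighbors `w i`, the coordinates `c i` in which the edge
directions at `v` are the standard basis, and a level `t` separating `v` from the other vertices. -/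
structure SimpleCorner (P : Set (Fin n → ℝ)) (d : ℕ) where
  v : Fin n → ℝ
  w : Fin d → Fin n → ℝ
  c : Fin d → (Fin n → ℝ) →ₗ[ℝ] ℝ
  t : ℝ
  v_mem : v ∈ P.extremePoints ℝ
  finite : (P.extremePoints ℝ).Finite
  convexHull_eq : convexHull ℝ (P.extremePoints ℝ) = P
  w_iff : ∀ u, (∃ i, w i = u) ↔ u ∈ P.extremePoints ℝ ∧ (edgeGraph P).Adj v u
  c_w : ∀ i j, c i (w j - v) = if i = j then 1 else 0
  c_nonneg : ∀ x ∈ P, ∀ i, 0 ≤ c i (x - v)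
  rep : ∀ x ∈ P, x - v = ∑ i, c i (x - v) • (w i - v)
  t_pos : 0 < t
  t_lt_one : t < 1
  t_lt : ∀ u ∈ P.extremePoints ℝ, u ≠ v → t < ∑ i, c i (u - v)

theorem exists_simpleCorner {d : ℕ} (hd0 : 0 < d) {S : Set (Fin n → ℝ)} (hS : S.Finite)
    (hd : adim (convexHull ℝ S) = d)
    (hlt : 2 * f₁ (convexHull ℝ S) < (d + 1) * f₀ (convexHull ℝ S)) :
    Nonempty (SimpleCorner (convexHull ℝ S) d) := by
  obtain ⟨v, hv, w, hw, hli, hinj⟩ := exists_simple_vertex hS hd hlt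
  have hVf : ((convexHull ℝ S).extremePoints ℝ).Finite :=
    hS.subset extremePoints_convexHull_subset
  have hnb : {u ∈ (convexHull ℝ S).extremePoints ℝ | (edgeGraph (convexHull ℝ S)).Adj v u} =
      range w := by
    ext u; exact (hw u).symm
  obtain ⟨g, hg⟩ := LinearMap.exists_leftInverse_of_injective
    (Fintype.linearCombination ℝ (fun i => w i - v))
    (by rw [LinearMap.ker_eq_bot]; exact hli.fintypeLinearCombination_injective)
  let c : Fin d → (Fin n → ℝ) →ₗ[ℝ] ℝ := fun i => LinearMap.proj i ∘ₗ g
  have hcw : ∀ i j, c i (w j - v) = if i = j then 1 else 0 := by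
    intro i j
    have h1 : g (w j - v) = Pi.single j 1 := by
      have := LinearMap.congr_fun hg (Pi.single j 1)
      rw [LinearMap.comp_apply, Fintype.linearCombination_apply_single, one_smul] at this
      exact this
    change g (w j - v) i = _
    rw [h1, Pi.single_apply]
  have hnn : ∀ x ∈ convexHull ℝ S, ∀ i, 0 ≤ c i (x - v) := by
    intro x hx i
    have := sub_mem_of_forall_adj hS hv (PointedCone.comap (c i) (PointedCone.positive ℝ ℝ))
      (fun u hu hvu => ?_) hx
    · simpa using this
    · obtain ⟨j, rfl⟩ := (hw u).2 ⟨hu, hvu⟩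
      have : 0 ≤ c i (w j - v) := by rw [hcw]; split_ifs <;> norm_num
      simpa using this
  have hrep : ∀ x ∈ convexHull ℝ S, x - v = ∑ i, c i (x - v) • (w i - v) := by
    intro x hx
    have h1 : x - v ∈ vectorSpan ℝ (convexHull ℝ S) := vsub_mem_vectorSpan ℝ hx hv.1
    rw [vectorSpan_eq_span_neighbors hS hv, hnb, ← range_comp] at h1
    obtain ⟨a, ha⟩ := (Submodule.mem_span_range_iff_exists_fun ℝ).1 h1
    simp only [Function.comp_apply] at ha
    have h2 : ∀ i, c i (x - v) = a i := by
      intro i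
      rw [← ha, map_sum]
      simp [hcw]
    simp only [h2, ha]
  have hpos : ∀ u ∈ (convexHull ℝ S).extremePoints ℝ \ {v}, 0 < ∑ i, c i (u - v) := by
    rintro u ⟨hu, huv⟩
    refine (Finset.sum_nonneg fun i _ => hnn u hu.1 i).lt_of_ne fun h => huv ?_
    have h0 := (Finset.sum_eq_zero_iff_of_nonneg fun i _ => hnn u hu.1 i).1 h.symm
    have := hrep u hu.1
    rw [Finset.sum_eq_zero fun i hi => by rw [h0 i hi, zero_smul]] at this
    exact sub_eq_zero.1 this
  have hw0 := (hw (w ⟨0, hd0⟩)).1 ⟨_, rfl⟩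
  have hne : ((convexHull ℝ S).extremePoints ℝ \ {v}).Nonempty :=
    ⟨w ⟨0, hd0⟩, hw0.1, fun h => hw0.2.1 h.symm⟩
  obtain ⟨u, hu, hmin⟩ := Set.exists_min_image _ (fun u => ∑ i, c i (u - v))
    (hVf.subset sdiff_subset) hne
  have hu0 := hpos u hu
  refine ⟨⟨v, w, c, min ((∑ i, c i (u - v)) / 2) (1 / 2), hv, hVf,
    convexHull_extremePoints_of_finite hS, hw, hcw, hnn, hrep, ?_, ?_, ?_⟩⟩
  · exact lt_min (by linarith) (by norm_num)
  · exact (min_le_right _ _).trans_lt (by norm_num)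
  · intro x hx hxv
    have := hmin x ⟨hx, hxv⟩
    exact (min_le_left _ _).trans_lt (by linarith)

namespace SimpleCorner

variable {P : Set (Fin n → ℝ)} {d : ℕ} (K : SimpleCorner P d)

/-- The height above the vertex. -/
def L : (Fin n → ℝ) →ₗ[ℝ] ℝ := ∑ i, K.c i

/-- The point where the edge to `w i` is cut. -/
def p (i : Fin d) : Fin n → ℝ := K.v + K.t • (K.w i - K.v)

/-- The apex stacked onto the cut. -/
noncomputable def q : Fin n → ℝ := K.v + (K.t / (2 * d)) • ∑ i, (K.w i - K.v)

/-- The vertices other than `v`. -/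
abbrev U (K : SimpleCorner P d) : Type := {u : Fin n → ℝ // u ∈ P.extremePoints ℝ ∧ u ≠ K.v}

/-- The vertices of the polytope obtained by cutting off `v` and stacking onto the cut. -/
noncomputable def pt : (K.U ⊕ Fin d) ⊕ Unit → Fin n → ℝ :=
  Sum.elim (Sum.elim Subtype.val K.p) (fun _ => K.q)

/-- The polytope obtained by cutting off `v` and stacking onto the cut. -/
def Q : Set (Fin n → ℝ) := convexHull ℝ (range K.pt)

theorem L_apply (x : Fin n → ℝ) : K.L x = ∑ i, K.c i x := by simp [L]

theorem L_w (i : Fin d) : K.L (K.w i - K.v) = 1 := by simp [L_apply, K.c_w]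

theorem p_sub (i : Fin d) : K.p i - K.v = K.t • (K.w i - K.v) := by simp [p]

theorem q_sub : K.q - K.v = (K.t / (2 * d)) • ∑ i, (K.w i - K.v) := by simp [q]

theorem c_p (i j : Fin d) : K.c i (K.p j - K.v) = if i = j then K.t else 0 := by
  simp [p_sub, K.c_w]

theorem L_p (i : Fin d) : K.L (K.p i - K.v) = K.t := by simp [p_sub, L_w]

theorem c_q (i : Fin d) : K.c i (K.q - K.v) = K.t / (2 * d) := by
  rw [q_sub, map_smul, map_sum]
  simp [K.c_w]

theorem L_q (hd : 3 ≤ d) : K.L (K.q - K.v) = K.t / 2 := by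
  have : (d : ℝ) ≠ 0 := by positivity
  simp only [L_apply, c_q, Finset.sum_const, Finset.card_univ, Fintype.card_fin, nsmul_eq_mul]
  field_simp

theorem w_mem (i : Fin d) : K.w i ∈ P.extremePoints ℝ := ((K.w_iff _).1 ⟨i, rfl⟩).1

theorem adj_w (i : Fin d) : (edgeGraph P).Adj K.v (K.w i) := ((K.w_iff _).1 ⟨i, rfl⟩).2

theorem w_ne (i : Fin d) : K.w i ≠ K.v := (K.adj_w i).1.symm

theorem convex (K : SimpleCorner P d) : Convex ℝ P := K.convexHull_eq ▸ convex_convexHull ℝ _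

theorem p_mem_segment (i : Fin d) : K.p i ∈ segment ℝ K.v (K.w i) :=
  ⟨1 - K.t, K.t, by linarith [K.t_lt_one], K.t_pos.le, by ring, by rw [p]; module⟩

theorem p_mem (i : Fin d) : K.p i ∈ P :=
  K.convex.segment_subset K.v_mem.1 (K.w_mem i).1 (K.p_mem_segment i)

theorem lt_L_U (u : K.U) : K.t < K.L (u - K.v) := by
  rw [L_apply]; exact K.t_lt u u.2.1 u.2.2

theorem L_nonneg {x : Fin n → ℝ} (hx : x ∈ P) : 0 ≤ K.L (x - K.v) := by
  rw [L_apply]; exact Finset.sum_nonneg fun i _ => K.c_nonneg x hx i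

theorem c_le_L {x : Fin n → ℝ} (hx : x ∈ P) (i : Fin d) : K.c i (x - K.v) ≤ K.L (x - K.v) := by
  rw [L_apply]
  exact Finset.single_le_sum (fun i _ => K.c_nonneg x hx i) (Finset.mem_univ i)

theorem c_add_c_le_L {x : Fin n → ℝ} (hx : x ∈ P) {i j : Fin d} (hij : i ≠ j) :
    K.c i (x - K.v) + K.c j (x - K.v) ≤ K.L (x - K.v) := by
  rw [L_apply, ← Finset.sum_pair hij (f := fun i => K.c i (x - K.v))]
  exact Finset.sum_le_sum_of_subset_of_nonneg (Finset.subset_univ _)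
    (fun i _ _ => K.c_nonneg x hx i)

/-- The section of `P` at height `t` is the simplex spanned by the cut points. -/
theorem mem_convexHull_p {x : Fin n → ℝ} (hx : x ∈ P) (hL : K.L (x - K.v) = K.t) :
    x ∈ convexHull ℝ (range K.p) := by
  have ht := K.t_pos
  have hsum : ∑ i, K.c i (x - K.v) / K.t = 1 := by
    rw [← Finset.sum_div, ← L_apply, hL, div_self ht.ne']
  have hx' : x = ∑ i, (K.c i (x - K.v) / K.t) • K.p i := by
    have h1 : ∑ i, (K.c i (x - K.v) / K.t) • K.p i =
        ∑ i, ((K.c i (x - K.v) / K.t) • K.v + K.c i (x - K.v) • (K.w i - K.v)) := by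
      refine Finset.sum_congr rfl fun i _ => ?_
      rw [p, smul_add, smul_smul, div_mul_cancel₀ _ ht.ne']
    rw [h1, Finset.sum_add_distrib, ← Finset.sum_smul, hsum, one_smul, ← K.rep x hx]
    abel
  rw [hx']
  exact (convex_convexHull ℝ _).sum_mem
    (fun i _ => div_nonneg (K.c_nonneg x hx i) ht.le) hsum
    (fun i _ => subset_convexHull ℝ _ ⟨i, rfl⟩)

theorem U_mem_Q (u : K.U) : (u : Fin n → ℝ) ∈ K.Q :=
  subset_convexHull ℝ _ ⟨.inl (.inl u), rfl⟩

theorem p_mem_Q (i : Fin d) : K.p i ∈ K.Q := subset_convexHull ℝ _ ⟨.inl (.inr i), rfl⟩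

theorem q_mem_Q : K.q ∈ K.Q := subset_convexHull ℝ _ ⟨.inr (), rfl⟩

theorem convexHull_p_subset : convexHull ℝ (range K.p) ⊆ K.Q :=
  convexHull_min (by rintro _ ⟨i, rfl⟩; exact K.p_mem_Q i) (convex_convexHull ℝ _)

theorem q_mem (hd : 3 ≤ d) : K.q ∈ P := by
  have h0 : (d : ℝ) ≠ 0 := by positivity
  have hcm : ∑ i : Fin d, (1 / (d : ℝ)) • (K.v + (K.t / 2) • (K.w i - K.v)) ∈ P := by
    refine K.convex.sum_mem (fun i _ => by positivity) (by simp [h0]) fun i _ => ?_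
    refine K.convex.segment_subset K.v_mem.1 (K.w_mem i).1
      ⟨1 - K.t / 2, K.t / 2, by linarith [K.t_lt_one], by linarith [K.t_pos], by ring, by module⟩
  convert! hcm using 1
  simp only [smul_add, smul_smul, Finset.sum_add_distrib, Finset.sum_const, Finset.card_univ,
    Fintype.card_fin]
  rw [← Finset.smul_sum, q, ← Nat.cast_smul_eq_nsmul ℝ, smul_smul, mul_one_div_cancel h0, one_smul]
  congr 2
  field_simp

theorem pt_mem (hd : 3 ≤ d) (x : (K.U ⊕ Fin d) ⊕ Unit) : K.pt x ∈ P := by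
  rcases x with (u | i) | _
  exacts [u.2.1.1, K.p_mem i, K.q_mem hd]

theorem Q_subset (hd : 3 ≤ d) : K.Q ⊆ P :=
  convexHull_min (by rintro _ ⟨x, rfl⟩; exact K.pt_mem hd x) K.convex

theorem forall_range_pt {p : (Fin n → ℝ) → Prop} (hU : ∀ u : K.U, p u) (hp : ∀ i, p (K.p i))
    (hq : p K.q) : ∀ x ∈ range K.pt, p x := by
  rintro _ ⟨(u | i) | _, rfl⟩
  exacts [hU u, hp i, hq]

/-- The part of `P` above the cut is kept. -/
theorem mem_Q_of_le (hd : 3 ≤ d) {x : Fin n → ℝ} (hx : x ∈ P) (hL : K.t ≤ K.L (x - K.v)) :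
    x ∈ K.Q := by
  have ht := K.t_pos
  have hVU : P.extremePoints ℝ = insert K.v (range (Subtype.val : K.U → Fin n → ℝ)) := by
    ext u
    simp only [Subtype.range_coe_subtype, mem_insert_iff, mem_ofPred_eq]
    constructor
    · intro h
      by_cases huv : u = K.v
      exacts [.inl huv, .inr ⟨h, huv⟩]
    · rintro (rfl | h)
      exacts [K.v_mem, h.1]
  have hne : (range (Subtype.val : K.U → Fin n → ℝ)).Nonempty :=
    ⟨_, ⟨⟨K.w ⟨0, by omega⟩, K.w_mem _, K.w_ne _⟩, rfl⟩⟩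
  have hx' := hx
  rw [← K.convexHull_eq, hVU, convexHull_insert hne, mem_convexJoin] at hx'
  obtain ⟨a, ha, y, hy, hxy⟩ := hx'
  rw [mem_singleton_iff] at ha
  subst ha
  have hyP : y ∈ P := by
    rw [← K.convexHull_eq, hVU]; exact convexHull_mono (subset_insert _ _) hy
  have hyQ : y ∈ K.Q :=
    convexHull_min (by rintro _ ⟨u, rfl⟩; exact K.U_mem_Q u) (convex_convexHull ℝ _) hy
  have hyL : K.t < K.L (y - K.v) := by
    have : convexHull ℝ (range (Subtype.val : K.U → Fin n → ℝ)) ⊆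
        {z | K.t + K.L K.v < K.L z} := by
      refine convexHull_min ?_ (convex_halfSpace_gt K.L.isLinear _)
      rintro _ ⟨u, rfl⟩
      have := K.lt_L_U u
      rw [map_sub] at this
      exact (by linarith : K.t + K.L K.v < K.L u)
    have h : K.t + K.L K.v < K.L y := this hy
    rw [map_sub]; linarith
  set l := K.L (y - K.v) with hl
  have hl0 : 0 < l := ht.trans hyL
  obtain ⟨α, r, hα, hr, hαr, rfl⟩ := hxy
  obtain rfl : α = 1 - r := by linarith
  have hxv : (1 - r) • K.v + r • y - K.v = r • (y - K.v) := by module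
  rw [hxv, map_smul, smul_eq_mul, ← hl] at hL
  have hτ1 : K.t / l < 1 := (div_lt_one hl0).2 hyL
  have hτr : K.t / l ≤ r := (div_le_iff₀ hl0).2 hL
  have hτ0 : 0 < K.t / l := by positivity
  set τ := K.t / l with hτ
  have hy' : (1 - τ) • K.v + τ • y ∈ K.Q := by
    refine K.convexHull_p_subset (K.mem_convexHull_p
      (K.convex K.v_mem.1 hyP (by linarith) hτ0.le (by ring)) ?_)
    rw [show (1 - τ) • K.v + τ • y - K.v = τ • (y - K.v) by module, map_smul, smul_eq_mul, ← hl,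
      hτ, div_mul_cancel₀ _ hl0.ne']
  have h1τ : 0 < 1 - τ := by linarith
  have hmem : (1 - (r - τ) / (1 - τ)) • ((1 - τ) • K.v + τ • y) + ((r - τ) / (1 - τ)) • y ∈
      K.Q := by
    refine convex_convexHull ℝ _ hy' hyQ ?_ ?_ (by ring)
    · rw [sub_nonneg, div_le_one h1τ]; linarith
    · exact div_nonneg (by linarith) h1τ.le
  convert hmem using 1
  have e1 : (1 - (r - τ) / (1 - τ)) * (1 - τ) = 1 - r := by field_simp; ring
  have e2 : (1 - (r - τ) / (1 - τ)) * τ + (r - τ) / (1 - τ) = r := by field_simp; ring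
  rw [smul_add, smul_smul, smul_smul, add_assoc, ← add_smul, e1, e2]

theorem U_mem_extremePoints (hd : 3 ≤ d) (u : K.U) : (u : Fin n → ℝ) ∈ K.Q.extremePoints ℝ :=
  inter_extremePoints_subset_extremePoints_of_subset (K.Q_subset hd) ⟨K.U_mem_Q u, u.2.1⟩

theorem p_inj : Function.Injective K.p := by
  intro i j h
  have := K.c_p i j
  rw [← h, c_p, if_pos rfl] at this
  by_contra hij
  rw [if_neg hij] at this
  exact K.t_pos.ne' this

theorem isExtreme_p_p (hd : 3 ≤ d) {i j : Fin d} (hij : i ≠ j) :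
    IsExtreme ℝ K.Q (segment ℝ (K.p i) (K.p j)) := by
  have ht := K.t_pos
  have hd' : (3 : ℝ) ≤ d := by exact_mod_cast hd
  set M : ℝ := 2 * d / (d - 2) with hM
  have hM0 : 0 < M := div_pos (by linarith) (by linarith)
  have hMd : M * (d - 2) = 2 * d := div_mul_cancel₀ _ (by linarith)
  refine isExtreme_segment_of_le ((1 + M) • K.L - M • (K.c i + K.c j)) (m := K.t) (v := K.v)
    ⟨.inl (.inr i), rfl⟩ ⟨.inl (.inr j), rfl⟩ ?_ ?_ (K.forall_range_pt ?_ ?_ ?_)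
  · simp [L_p, c_p, hij.symm]; ring
  · simp [L_p, c_p, hij]; ring
  · intro u
    left
    have h1 := K.c_add_c_le_L u.2.1.1 hij
    have h2 := K.lt_L_U u
    simp only [LinearMap.sub_apply, LinearMap.smul_apply, LinearMap.add_apply, smul_eq_mul]
    nlinarith
  · intro k
    by_cases hki : i = k
    · subst hki; exact .inr (.inl rfl)
    by_cases hkj : j = k
    · subst hkj; exact .inr (.inr rfl)
    left
    simp [L_p, c_p, hki, hkj]
    nlinarith
  · left
    simp only [LinearMap.sub_apply, LinearMap.smul_apply, LinearMap.add_apply, smul_eq_mul, c_q,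
      L_q K hd]
    have e : (1 + M) * (K.t / 2) - M * (K.t / (2 * d) + K.t / (2 * d)) =
        K.t / 2 + (M * (d - 2)) * K.t / (2 * d) := by
      field_simp; ring
    rw [e, hMd, mul_div_cancel_left₀ _ (by positivity)]
    linarith

theorem p_mem_extremePoints (hd : 3 ≤ d) (i : Fin d) : K.p i ∈ K.Q.extremePoints ℝ := by
  have : Nontrivial (Fin d) := Fin.nontrivial_iff_two_le.2 (by omega)
  obtain ⟨j, hj⟩ := exists_ne i
  exact left_mem_extremePoints_of_isExtreme_segment (K.isExtreme_p_p hd hj.symm)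

theorem isExtreme_q_p (hd : 3 ≤ d) (i : Fin d) :
    IsExtreme ℝ K.Q (segment ℝ K.q (K.p i)) := by
  have ht := K.t_pos
  have hd' : (3 : ℝ) ≤ d := by exact_mod_cast hd
  set A : ℝ := d / (d - 1) with hA
  have hA0 : 0 < A := div_pos (by linarith) (by linarith)
  have hAd : A * (d - 1) = d := div_mul_cancel₀ _ (by linarith)
  refine isExtreme_segment_of_le ((1 + A) • K.L - A • K.c i) (m := K.t) (v := K.v)
    ⟨.inr (), rfl⟩ ⟨.inl (.inr i), rfl⟩ ?_ ?_ (K.forall_range_pt ?_ ?_ (.inr (.inl rfl)))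
  · simp only [LinearMap.sub_apply, LinearMap.smul_apply, smul_eq_mul, c_q, L_q K hd]
    have e : (1 + A) * (K.t / 2) - A * (K.t / (2 * d)) =
        K.t / 2 + (A * (d - 1)) * K.t / (2 * d) := by
      field_simp; ring
    rw [e, hAd, mul_comm 2 (d : ℝ), mul_div_mul_left _ _ (by positivity)]
    ring
  · simp [L_p, c_p]; ring
  · intro u
    left
    have h1 := K.c_le_L u.2.1.1 i
    have h2 := K.lt_L_U u
    simp only [LinearMap.sub_apply, LinearMap.smul_apply, smul_eq_mul]
    nlinarith
  · intro k
    by_cases hki : i = k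
    · subst hki; exact .inr (.inr rfl)
    left
    simp [L_p, c_p, hki]
    nlinarith

theorem q_mem_extremePoints (hd : 3 ≤ d) : K.q ∈ K.Q.extremePoints ℝ :=
  left_mem_extremePoints_of_isExtreme_segment (K.isExtreme_q_p hd ⟨0, by omega⟩)

theorem c_eq_zero_of_mem_segment {i j : Fin d} (hij : j ≠ i) {x : Fin n → ℝ}
    (hx : x ∈ segment ℝ K.v (K.w i)) : K.c j (x - K.v) = 0 := by
  rw [segment_eq_image'] at hx
  obtain ⟨r, -, rfl⟩ := hx
  simp [K.c_w, hij]

theorem isExtreme_p_w (hd : 3 ≤ d) (i : Fin d) :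
    IsExtreme ℝ K.Q (segment ℝ (K.p i) (K.w i)) := by
  have ht := K.t_pos
  have hsub := K.Q_subset hd
  have hF : IsExtreme ℝ K.Q (K.Q ∩ segment ℝ K.v (K.w i)) := by
    refine ⟨inter_subset_left, fun x hx y hy z hz hzxy => ⟨hx, ?_⟩⟩
    exact (K.adj_w i).2.2 (hsub hx) (hsub hy) hz.2 hzxy
  have hFc : Convex ℝ (K.Q ∩ segment ℝ K.v (K.w i)) :=
    (convex_convexHull ℝ _).inter (convex_segment _ _)
  convert! hF using 1
  apply Subset.antisymm
  · exact hFc.segment_subset ⟨K.p_mem_Q i, K.p_mem_segment i⟩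
      ⟨K.U_mem_Q ⟨K.w i, K.w_mem i, K.w_ne i⟩, right_mem_segment ℝ _ _⟩
  · have hF' := IsExtreme.eq_convexHull_inter (S := range K.pt) hF hFc
    rw [hF', ← convexHull_pair (𝕜 := ℝ) (K.p i) (K.w i)]
    refine convexHull_mono ?_
    rintro x ⟨⟨-, hx⟩, hxr⟩
    revert hx
    refine K.forall_range_pt
      (p := fun x => x ∈ segment ℝ K.v (K.w i) → x ∈ ({K.p i, K.w i} : Set _))
      ?_ ?_ ?_ x hxr
    · intro u hu
      rcases mem_segment_extremePoints K.v_mem.1 (K.w_mem i).1 u.2.1 hu with h | h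
      · exact absurd h u.2.2
      · exact .inr h
    · intro j hj
      by_cases hji : j = i
      · exact .inl (by rw [hji])
      · have := K.c_eq_zero_of_mem_segment hji hj
        rw [c_p, if_pos rfl] at this
        exact absurd this ht.ne'
    · intro hq
      have : Nontrivial (Fin d) := Fin.nontrivial_iff_two_le.2 (by omega)
      obtain ⟨j, hj⟩ := exists_ne i
      have := K.c_eq_zero_of_mem_segment hj hq
      rw [c_q] at this
      have h0 : (0 : ℝ) < d := by exact_mod_cast (by omega : 0 < d)
      exact absurd this (by positivity)

theorem not_isExtreme_q_U (hd : 3 ≤ d) (u : K.U) :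
    ¬ IsExtreme ℝ K.Q (segment ℝ K.q (u : Fin n → ℝ)) := by
  intro h
  have ht := K.t_pos
  have hu := K.lt_L_U u
  have hq := K.L_q hd
  set l := K.L (u - K.v) with hl
  have hl' : 0 < l - K.t / 2 := by linarith
  set r := (K.t / 2) / (l - K.t / 2) with hr
  have hr0 : 0 < r := by positivity
  have hr1 : r < 1 := (div_lt_one hl').2 (by linarith)
  have hx : (1 - r) • K.q + r • (u : Fin n → ℝ) ∈ segment ℝ K.q (u : Fin n → ℝ) :=
    ⟨1 - r, r, by linarith, hr0.le, by ring, rfl⟩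
  have hxP := K.convex.segment_subset (K.q_mem hd) u.2.1.1 hx
  have hxL : K.L ((1 - r) • K.q + r • (u : Fin n → ℝ) - K.v) = K.t := by
    rw [show (1 - r) • K.q + r • (u : Fin n → ℝ) - K.v =
      (1 - r) • (K.q - K.v) + r • ((u : Fin n → ℝ) - K.v) by module, map_add, map_smul, map_smul,
      hq, ← hl, smul_eq_mul, smul_eq_mul]
    have : r * (l - K.t / 2) = K.t / 2 := div_mul_cancel₀ _ hl'.ne'
    linarith
  obtain ⟨_, ⟨i, rfl⟩, hi⟩ := h.exists_mem_of_mem_convexHull (convex_convexHull ℝ _)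
    (by rintro _ ⟨i, rfl⟩; exact K.p_mem_Q i) hx (K.mem_convexHull_p hxP hxL)
  have hpL := K.L_p i
  rcases mem_segment_extremePoints K.q_mem_Q (K.U_mem_Q u) (K.p_mem_extremePoints hd i) hi
    with h | h
  · rw [h, hq] at hpL; linarith
  · rw [h] at hpL; linarith

theorem not_isExtreme_p_U (hd : 3 ≤ d) (i : Fin d) (u : K.U) (hu : K.w i ≠ u) :
    ¬ IsExtreme ℝ K.Q (segment ℝ (K.p i) (u : Fin n → ℝ)) := by
  intro h
  have ht := K.t_pos
  have ht1 := K.t_lt_one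
  have hul := K.lt_L_U u
  set l := K.L (u - K.v) with hl
  have hl0 : 0 < l := ht.trans hul
  set r := K.t / l with hr
  have hr0 : 0 < r := by positivity
  have hr1 : r < 1 := (div_lt_one hl0).2 hul
  set y : Fin n → ℝ := (1 - r) • K.v + r • (u : Fin n → ℝ) with hy
  have hyP : y ∈ P := K.convex K.v_mem.1 u.2.1.1 (by linarith) hr0.le (by ring)
  have hyQ : y ∈ K.Q := by
    refine K.convexHull_p_subset (K.mem_convexHull_p hyP ?_)
    rw [hy, show (1 - r) • K.v + r • (u : Fin n → ℝ) - K.v = r • ((u : Fin n → ℝ) - K.v) by module,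
      map_smul, smul_eq_mul, ← hl, hr, div_mul_cancel₀ _ hl0.ne']
  have htr : 0 < 1 - K.t * r := by nlinarith
  set α := K.t * (1 - r) / (1 - K.t * r) with hα
  have hα0 : 0 < α := div_pos (mul_pos ht (by linarith)) htr
  have hα1 : α < 1 := (div_lt_one htr).2 (by linarith)
  have hαe : α * (1 - K.t * r) = K.t * (1 - r) := div_mul_cancel₀ _ htr.ne'
  have hz : α • K.w i + (1 - α) • y =
      (1 - (1 - α) * r) • K.p i + ((1 - α) * r) • (u : Fin n → ℝ) := by
    have : α = (1 - (1 - α) * r) * K.t := by linarith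
    rw [p, hy]
    have e1 : (1 - (1 - α) * r) • (K.v + K.t • (K.w i - K.v)) =
      (1 - (1 - α) * r) • K.v + ((1 - (1 - α) * r) * K.t) • (K.w i - K.v) := by module
    rw [e1, ← this]; module
  have hwQ : K.w i ∈ K.Q := K.U_mem_Q ⟨K.w i, K.w_mem i, K.w_ne i⟩
  have hw := h.2 hwQ hyQ (z := α • K.w i + (1 - α) • y)
    ⟨1 - (1 - α) * r, (1 - α) * r, by nlinarith, by nlinarith, by ring, hz.symm⟩
    ⟨α, 1 - α, hα0, by linarith, by ring, rfl⟩
  rcases mem_segment_extremePoints (K.p_mem_Q i) (K.U_mem_Q u)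
    (K.U_mem_extremePoints hd ⟨K.w i, K.w_mem i, K.w_ne i⟩) hw with h | h
  · have h1 := K.L_w i
    have h2 := K.L_p i
    simp only at h
    rw [← h] at h2; linarith
  · exact hu h

theorem isExtreme_U_U_iff (hd : 3 ≤ d) (u u' : K.U) :
    IsExtreme ℝ K.Q (segment ℝ (u : Fin n → ℝ) u') ↔
      IsExtreme ℝ P (segment ℝ (u : Fin n → ℝ) u') := by
  have hseg : segment ℝ (u : Fin n → ℝ) u' ⊆ K.Q :=
    (convex_convexHull ℝ _).segment_subset (K.U_mem_Q u) (K.U_mem_Q u')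
  refine ⟨fun h => ⟨K.convex.segment_subset u.2.1.1 u'.2.1.1, ?_⟩,
    fun h => h.mono (K.Q_subset hd) hseg⟩
  intro a ha b hb z hz hzab
  have ht := K.t_pos
  have hzL : K.t < K.L (z - K.v) := by
    have h1 := K.lt_L_U u
    have h2 := K.lt_L_U u'
    obtain ⟨α, β, hα, hβ, hαβ, rfl⟩ := hz
    obtain rfl : α = 1 - β := by linarith
    rw [show (1 - β) • (u : Fin n → ℝ) + β • (u' : Fin n → ℝ) - K.v =
      (1 - β) • ((u : Fin n → ℝ) - K.v) + β • ((u' : Fin n → ℝ) - K.v) by module, map_add, map_smul,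
      map_smul, smul_eq_mul, smul_eq_mul]
    rcases hα.eq_or_lt with h | h
    · rw [← h]; obtain rfl : β = 1 := by linarith
      linarith
    · nlinarith
  set l := K.L (z - K.v) with hl
  have hl0 : 0 < l := ht.trans hzL
  have hzP : z ∈ P := K.Q_subset hd (hseg hz)
  set ε := 1 - K.t / l with hε
  have htl : K.t / l < 1 := (div_lt_one hl0).2 hzL
  have htl0 : 0 < K.t / l := by positivity
  have hε0 : 0 < ε := by linarith
  have hclose : ∀ x ∈ P, (1 - ε) • z + ε • x ∈ K.Q := by
    intro x hx
    refine K.mem_Q_of_le hd (K.convex hzP hx (by linarith) hε0.le (by ring)) ?_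
    have h1 := K.L_nonneg hx
    rw [show (1 - ε) • z + ε • x - K.v = (1 - ε) • (z - K.v) + ε • (x - K.v) by module, map_add,
      map_smul, map_smul, smul_eq_mul, smul_eq_mul, ← hl, hε, sub_sub_cancel,
      div_mul_cancel₀ _ hl0.ne', ← hε]
    nlinarith
  have ha' := h.2 (hclose a ha) (hclose b hb) hz (by
    obtain ⟨α, β, hα, hβ, hαβ, he⟩ := hzab
    refine ⟨α, β, hα, hβ, hαβ, ?_⟩
    rw [show α • ((1 - ε) • z + ε • a) + β • ((1 - ε) • z + ε • b) =
      (α + β) • (1 - ε) • z + ε • (α • a + β • b) by module, hαβ, he]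
    module)
  rw [segment_eq_image'] at hz ha'
  obtain ⟨r, -, hr⟩ := hz
  obtain ⟨s, -, hs⟩ := ha'
  refine mem_segment_of_sub_eq_smul u.2.1 u'.2.1 ha (r := r + ε⁻¹ * (s - r)) ?_
  have hε' : ε⁻¹ * ε = 1 := inv_mul_cancel₀ hε0.ne'
  have e : a = z + ε⁻¹ • (((1 - ε) • z + ε • a) - z) := by
    rw [show ((1 - ε) • z + ε • a) - z = ε • (a - z) by module, smul_smul, hε']; module
  rw [e, ← hs, ← hr]
  module

theorem w_inj : Function.Injective K.w := by
  intro i j h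
  have := K.c_w i j
  rw [← h, c_w, if_pos rfl] at this
  by_contra hij
  rw [if_neg hij] at this
  exact one_ne_zero this

theorem pt_mem_extremePoints (hd : 3 ≤ d) (x : (K.U ⊕ Fin d) ⊕ Unit) :
    K.pt x ∈ K.Q.extremePoints ℝ := by
  rcases x with (u | i) | _
  exacts [K.U_mem_extremePoints hd u, K.p_mem_extremePoints hd i, K.q_mem_extremePoints hd]

theorem pt_inj (hd : 3 ≤ d) : Function.Injective K.pt := by
  have ht := K.t_pos
  have hq := K.L_q hd
  have hqp (i) : K.q ≠ K.p i := fun h => by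
    have := K.L_p i
    rw [← h, hq] at this
    linarith
  have hqU (u : K.U) : K.q ≠ u := fun h => by
    have := K.lt_L_U u
    rw [← h, hq] at this
    linarith
  have hpU (i) (u : K.U) : K.p i ≠ u := fun h => by
    have := K.lt_L_U u
    rw [← h, L_p] at this
    linarith
  rintro ((u | i) | _) ((u' | j) | _) h
  · rw [Subtype.ext h]
  · exact absurd h.symm (hpU j u)
  · exact absurd h.symm (hqU u)
  · exact absurd h (hpU i u')
  · rw [K.p_inj h]
  · exact absurd h.symm (hqp i)
  · exact absurd h (hqU u')
  · exact absurd h (hqp j)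
  · rfl

theorem adj_U_U (hd : 3 ≤ d) (u u' : K.U) :
    (edgeGraph K.Q).Adj u u' ↔ (edgeGraph P).Adj u u' :=
  and_congr_right fun _ => K.isExtreme_U_U_iff hd u u'

theorem adj_p_U (hd : 3 ≤ d) (i : Fin d) (u : K.U) :
    (edgeGraph K.Q).Adj (K.p i) u ↔ K.w i = u := by
  refine ⟨fun h => by_contra fun hu => K.not_isExtreme_p_U hd i u hu h.2, fun h => ⟨?_, ?_⟩⟩
  · exact fun h' => nomatch K.pt_inj hd (a₁ := .inl (.inr i)) (a₂ := .inl (.inl u)) h'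
  · rw [← h]; exact K.isExtreme_p_w hd i

theorem adj_p_p (hd : 3 ≤ d) (i j : Fin d) :
    (edgeGraph K.Q).Adj (K.p i) (K.p j) ↔ i ≠ j :=
  ⟨fun h hij => h.1 (by rw [hij]), fun h => ⟨K.p_inj.ne h, K.isExtreme_p_p hd h⟩⟩

theorem adj_q_p (hd : 3 ≤ d) (i : Fin d) : (edgeGraph K.Q).Adj K.q (K.p i) :=
  ⟨fun h => (nomatch K.pt_inj hd (a₁ := .inr ()) (a₂ := .inl (.inr i)) h), K.isExtreme_q_p hd i⟩

theorem not_adj_q_U (hd : 3 ≤ d) (u : K.U) : ¬ (edgeGraph K.Q).Adj K.q u :=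
  fun h => K.not_isExtreme_q_U hd u h.2

open Classical in
theorem f_vector_Q (hd : 3 ≤ d) :
    f₀ K.Q = f₀ P + d ∧ 2 * f₁ K.Q = 2 * f₁ P + d * (d + 1) := by
  let _ : Fintype K.U := (K.finite.subset fun _ h => h.1).fintype
  let ptP : K.U ⊕ Unit → Fin n → ℝ := Sum.elim Subtype.val fun _ => K.v
  have hrange : range ptP = P.extremePoints ℝ := by
    ext x
    constructor
    · rintro ⟨u | _, rfl⟩
      exacts [u.2.1, K.v_mem]
    · intro hx
      by_cases h : x = K.v
      · exact ⟨.inr (), h.symm⟩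
      · exact ⟨.inl ⟨x, hx, h⟩, rfl⟩
  have hinj : Function.Injective ptP := by
    rintro (u | _) (u' | _) h
    · rw [Subtype.ext h]
    · exact absurd h u.2.2
    · exact absurd h.symm u'.2.2
    · rfl
  obtain ⟨hP0, hP1⟩ := f_vector_of_parametrization hinj (by rw [hrange, K.convexHull_eq])
    (fun i => hrange ▸ mem_range_self i)
  obtain ⟨hQ0, hQ1⟩ := f_vector_of_parametrization (P := K.Q) (K.pt_inj hd) rfl
    (K.pt_mem_extremePoints hd)
  have hvU (u : K.U) : (edgeGraph P).Adj K.v u ↔ ∃ i, K.w i = u :=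
    ⟨fun h => (K.w_iff u).2 ⟨u.2.1, h⟩, fun h => ((K.w_iff u).1 h).2⟩
  have hsum : ∑ u : K.U, ∑ i, (if K.w i = (u : Fin n → ℝ) then 1 else 0) = d := by
    rw [Finset.sum_comm]
    calc ∑ i, ∑ u : K.U, (if K.w i = (u : Fin n → ℝ) then 1 else 0) = ∑ i : Fin d, 1 := by
          refine Finset.sum_congr rfl fun i _ => ?_
          rw [Finset.sum_eq_single_of_mem ⟨K.w i, K.w_mem i, K.w_ne i⟩ (Finset.mem_univ _),
            if_pos rfl]
          intro u _ hu
          rw [if_neg fun h => hu (Subtype.ext h.symm)]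
      _ = d := by simp
  have hsum' :
      ∑ u : K.U, (if (edgeGraph P).Adj K.v u then 1 else 0) = d := by
    refine Eq.trans ?_ hsum
    refine Finset.sum_congr rfl fun u _ => ?_
    split_ifs with h
    · obtain ⟨i, hi⟩ := (hvU u).1 h
      rw [Finset.sum_eq_single_of_mem i (Finset.mem_univ _), if_pos hi]
      intro j _ hj
      rw [if_neg fun h => hj (K.w_inj (h.trans hi.symm))]
    · rw [Finset.sum_eq_zero]
      intro i _
      rw [if_neg fun hi => h ((hvU u).2 ⟨i, hi⟩)]
  have hpp : ∑ i : Fin d, ∑ j : Fin d, (if i ≠ j then 1 else 0) = d * (d - 1) := by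
    simp [Finset.sum_ite, Finset.filter_ne, Finset.card_erase_of_mem]
  have hdd : d * (d - 1) + d * 2 = d * (d + 1) := by
    obtain ⟨e, rfl⟩ : ∃ e, d = e + 1 := ⟨d - 1, by omega⟩
    simp; ring
  have hsum2 := hsum
  rw [Finset.sum_comm] at hsum2
  constructor
  · rw [hP0, hQ0]; simp; omega
  · have a1 (u u' : K.U) : (if (edgeGraph P).Adj (ptP (.inl u)) (ptP (.inl u')) then 1 else 0) =
        if (edgeGraph P).Adj u u' then 1 else 0 := rfl
    have a2 (u : K.U) (x : Unit) :
        (if (edgeGraph P).Adj (ptP (.inl u)) (ptP (.inr x)) then 1 else 0) =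
          if (edgeGraph P).Adj K.v u then 1 else 0 := if_congr ((edgeGraph P).adj_comm _ _) rfl rfl
    have a3 (u : K.U) (x : Unit) :
        (if (edgeGraph P).Adj (ptP (.inr x)) (ptP (.inl u)) then 1 else 0) =
          if (edgeGraph P).Adj K.v u then 1 else 0 := rfl
    have a4 (x y : Unit) : (if (edgeGraph P).Adj (ptP (.inr x)) (ptP (.inr y)) then 1 else 0) = 0 :=
      if_neg (SimpleGraph.irrefl _)
    have b1 (u u' : K.U) : (if (edgeGraph K.Q).Adj (K.pt (.inl (.inl u)))
        (K.pt (.inl (.inl u'))) then 1 else 0) =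
        if (edgeGraph P).Adj u u' then 1 else 0 := if_congr (K.adj_U_U hd u u') rfl rfl
    have b2 (u : K.U) (i : Fin d) : (if (edgeGraph K.Q).Adj (K.pt (.inl (.inl u)))
        (K.pt (.inl (.inr i))) then 1 else 0) = if K.w i = u then 1 else 0 :=
      if_congr (((edgeGraph K.Q).adj_comm _ _).trans (K.adj_p_U hd i u)) rfl rfl
    have b3 (u : K.U) (i : Fin d) : (if (edgeGraph K.Q).Adj (K.pt (.inl (.inr i)))
        (K.pt (.inl (.inl u))) then 1 else 0) = if K.w i = u then 1 else 0 :=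
      if_congr (K.adj_p_U hd i u) rfl rfl
    have b4 (i j : Fin d) : (if (edgeGraph K.Q).Adj (K.pt (.inl (.inr i)))
        (K.pt (.inl (.inr j))) then 1 else 0) = if i ≠ j then 1 else 0 :=
      if_congr (K.adj_p_p hd i j) rfl rfl
    have b5 (u : K.U) (x : Unit) : (if (edgeGraph K.Q).Adj (K.pt (.inl (.inl u)))
        (K.pt (.inr x)) then 1 else 0) = 0 :=
      if_neg fun h => K.not_adj_q_U hd u (SimpleGraph.Adj.symm h)
    have b6 (u : K.U) (x : Unit) : (if (edgeGraph K.Q).Adj (K.pt (.inr x))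
        (K.pt (.inl (.inl u))) then 1 else 0) = 0 := if_neg (K.not_adj_q_U hd u)
    have b7 (i : Fin d) (x : Unit) : (if (edgeGraph K.Q).Adj (K.pt (.inl (.inr i)))
        (K.pt (.inr x)) then 1 else 0) = 1 := if_pos (K.adj_q_p hd i).symm
    have b8 (i : Fin d) (x : Unit) : (if (edgeGraph K.Q).Adj (K.pt (.inr x))
        (K.pt (.inl (.inr i))) then 1 else 0) = 1 := if_pos (K.adj_q_p hd i)
    have b9 (x y : Unit) : (if (edgeGraph K.Q).Adj (K.pt (.inr x)) (K.pt (.inr y)) then 1 else 0) =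
        0 := if_neg (SimpleGraph.irrefl _)
    rw [hP1, hQ1]
    simp only [Fintype.sum_sum_type, Finset.univ_unique, Finset.sum_singleton, a1, a2, a3, a4,
      b1, b2, b3, b4, b5, b6, b7, b8, b9, Finset.sum_add_distrib, hsum, hsum2, hsum', hpp,
      Finset.sum_const_zero, Finset.sum_const, Finset.card_univ, Fintype.card_fin, smul_eq_mul]
    rw [← hdd]
    ring

theorem adim_Q (hd : 3 ≤ d) : adim K.Q = adim P := by
  suffices h : vectorSpan ℝ K.Q = vectorSpan ℝ P by rw [adim, h, adim]
  have ht1 := K.t_lt_one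
  refine le_antisymm (vectorSpan_mono ℝ (K.Q_subset hd)) ?_
  have key : ∀ x ∈ P, x - K.v ∈ vectorSpan ℝ K.Q := by
    intro x hx
    rw [K.rep x hx]
    refine Submodule.sum_mem _ fun i _ => Submodule.smul_mem _ _ ?_
    have h : K.w i - K.v = (1 - K.t)⁻¹ • (K.w i - K.p i) := by
      have : K.w i - K.p i = (1 - K.t) • (K.w i - K.v) := by rw [p]; module
      rw [this, smul_smul, inv_mul_cancel₀ (by linarith), one_smul]
    rw [h]
    exact Submodule.smul_mem _ _
      (vsub_mem_vectorSpan ℝ (K.U_mem_Q ⟨K.w i, K.w_mem i, K.w_ne i⟩) (K.p_mem_Q i))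
  rw [vectorSpan_def, Submodule.span_le]
  rintro _ ⟨x, hx, y, hy, rfl⟩
  have := Submodule.sub_mem _ (key x hx) (key y hy)
  rwa [sub_sub_sub_cancel_right] at this

theorem isDPolytope_Q (hd : 3 ≤ d) (hP : adim P = d) : IsDPolytope d K.Q := by
  have : Finite K.U := K.finite.subset fun _ h => h.1
  exact ⟨⟨(finite_range K.pt).toFinset, by rw [Finite.coe_toFinset, Q]⟩, K.adim_Q hd ▸ hP⟩

end SimpleCorner

/-- A polytope with few edges has a simple vertex; cutting it off and stacking onto the cut
yields a new polytope. -/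
theorem fPairs_add {d N M k : ℕ} (hd : 3 ≤ d) (hk : 2 * k = d * (d + 1))
    (hlt : 2 * M < (d + 1) * N) (h : (N, M) ∈ fPairs d) : (N + d, M + k) ∈ fPairs d := by
  obtain ⟨n, P, ⟨⟨S, rfl⟩, hdim⟩, rfl, rfl⟩ := h
  obtain ⟨K⟩ := exists_simpleCorner (by omega) S.finite_toSet hdim hlt
  obtain ⟨h0, h1⟩ := K.f_vector_Q hd
  exact ⟨n, K.Q, K.isDPolytope_Q hd hdim, h0, by simp only; omega⟩

theorem fPairs_six_add_six {f0 : ℕ} (h : (f0 + 1, 7 * f0 / 2 + 1) ∈ fPairs 6) :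
    (f0 + 7, 7 * (f0 + 6) / 2 + 1) ∈ fPairs 6 := by
  have := fPairs_add (k := 21) (by norm_num) (by norm_num) (by omega) h
  convert! this using 2
  omega

section Certificate

variable {N m : ℕ} (A : Fin N → Fin n → ℤ) (H : Fin m → Fin n → ℤ) (b : Fin m → ℤ)

/-- The slack of the point `A k` in the inequality `b l ≤ H l ⬝ᵥ x`. -/
def slack (l : Fin m) (k : Fin N) : ℤ := ∑ c, H l c * A k c - b l

/-- The inequalities tight at both `A i` and `A j` determine these two points. -/
abbrev FaceAdj (i j : Fin N) : Prop :=
  i ≠ j ∧ ∀ k, k ≠ i → k ≠ j →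
    ∃ l, slack A H b l i = 0 ∧ slack A H b l j = 0 ∧ slack A H b l k ≠ 0

/-- The only positive entries of `r` are those at `i` and `j`. -/
abbrev PosAt (r : Fin N → ℤ) (i j : Fin N) : Prop :=
  0 < r i ∧ 0 < r j ∧ ∀ k, k ≠ i → k ≠ j → r k ≤ 0

/-- The real point with integer coordinates `A k`. -/
def realPt (k : Fin N) : Fin n → ℝ := fun c => A k c

variable {A H b}

theorem FaceAdj.isExtreme (hb : ∀ l k, 0 ≤ slack A H b l k) {i j : Fin N}
    (h : FaceAdj A H b i j) :
    IsExtreme ℝ (convexHull ℝ (range (realPt A))) (segment ℝ (realPt A i) (realPt A j)) := by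
  let T : Finset (Fin m) := {l | slack A H b l i = 0 ∧ slack A H b l j = 0}
  let f : (Fin n → ℝ) →ₗ[ℝ] ℝ := ∑ l ∈ T, ∑ c, (H l c : ℝ) • LinearMap.proj c
  have hf (k : Fin N) : f (realPt A k - 0) =
      ((∑ l ∈ T, slack A H b l k : ℤ) : ℝ) + ∑ l ∈ T, (b l : ℝ) := by
    rw [sub_zero, Int.cast_sum, ← Finset.sum_add_distrib]
    simp [f, slack, realPt]
  refine isExtreme_segment_of_le f (m := ∑ l ∈ T, (b l : ℝ)) (v := 0) ⟨i, rfl⟩ ⟨j, rfl⟩ ?_ ?_ ?_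
  · rw [hf, Finset.sum_eq_zero fun l hl => (Finset.mem_filter.1 hl).2.1]; simp
  · rw [hf, Finset.sum_eq_zero fun l hl => (Finset.mem_filter.1 hl).2.2]; simp
  · rintro _ ⟨k, rfl⟩
    by_cases hki : k = i
    · exact .inr (.inl (by rw [hki]))
    by_cases hkj : k = j
    · exact .inr (.inr (by rw [hkj]))
    left
    obtain ⟨l, hli, hlj, hlk⟩ := h.2 k hki hkj
    rw [hf, lt_add_iff_pos_left, Int.cast_pos]
    exact Finset.sum_pos' (fun l _ => hb l k)
      ⟨l, Finset.mem_filter.2 ⟨Finset.mem_univ _, hli, hlj⟩, (hb l k).lt_of_ne' hlk⟩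

/-- An affine relation whose only positive coefficients are at `i` and `j` shows that `A i` and
`A j` are not joined by an edge. -/
theorem PosAt.not_isExtreme (hA : Function.Injective (realPt A))
    (hext : ∀ i, realPt A i ∈ (convexHull ℝ (range (realPt A))).extremePoints ℝ)
    {r : Fin N → ℤ} (hr : ∑ k, r k = 0) (hrA : ∀ c, ∑ k, r k * A k c = 0)
    {i j : Fin N} (hij : i ≠ j) (h : PosAt r i j) :
    ¬ IsExtreme ℝ (convexHull ℝ (range (realPt A))) (segment ℝ (realPt A i) (realPt A j)) := by
  intro hE
  obtain ⟨hi, hj, hk⟩ := h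
  have hi' : (0 : ℝ) < r i := by exact_mod_cast hi
  have hj' : (0 : ℝ) < r j := by exact_mod_cast hj
  let s : Finset (Fin N) := Finset.univ \ {i, j}
  have hs0 : (r i + r j : ℝ) = ∑ k ∈ s, -(r k : ℝ) := by
    have h1 : (∑ k, (r k : ℝ)) = 0 := by exact_mod_cast hr
    rw [← Finset.sum_sdiff (Finset.subset_univ {i, j}), Finset.sum_pair hij] at h1
    rw [Finset.sum_neg_distrib]
    linarith
  have hs1 : (r i : ℝ) • realPt A i + (r j : ℝ) • realPt A j =
      ∑ k ∈ s, (-(r k : ℝ)) • realPt A k := by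
    have h1 : (∑ k, (r k : ℝ) • realPt A k) = 0 := by
      ext c
      simp only [Finset.sum_apply, Pi.smul_apply, realPt, smul_eq_mul, Pi.zero_apply]
      exact_mod_cast hrA c
    rw [← Finset.sum_sdiff (Finset.subset_univ {i, j}), Finset.sum_pair hij] at h1
    simp only [neg_smul, Finset.sum_neg_distrib]
    exact eq_neg_of_add_eq_zero_right h1
  have hsum : (0 : ℝ) < r i + r j := by linarith
  obtain ⟨y, ⟨k, hks, rfl⟩, hy⟩ := hE.exists_mem_of_mem_convexHull (convex_convexHull ℝ _)
    (T := realPt A '' s) ((image_subset_range _ _).trans (subset_convexHull ℝ _))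
    (x := s.centerMass (fun k => -(r k : ℝ)) (realPt A))
    (by
      rw [Finset.centerMass, ← hs1, ← hs0]
      refine ⟨r i / (r i + r j), r j / (r i + r j), by positivity, by positivity, by field_simp, ?_⟩
      rw [smul_add, smul_smul, smul_smul, div_eq_inv_mul, div_eq_inv_mul])
    (Finset.centerMass_mem_convexHull _ (fun k hk' => by
        have : k ≠ i ∧ k ≠ j := by simpa [s] using hk'
        have := hk k this.1 this.2
        have : (r k : ℝ) ≤ 0 := by exact_mod_cast this
        linarith) (by rw [← hs0]; exact hsum) fun k hk => mem_image_of_mem _ hk)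
  have hk' : k ≠ i ∧ k ≠ j := by simpa [s] using hks
  rcases mem_segment_extremePoints (hext i).1 (hext j).1 (hext k) hy with h | h
  · exact hk'.1 (hA h)
  · exact hk'.2 (hA h)

/-- The `f`-vector of a polytope with integer vertices `A k` from valid inequalities `H`, `b`
and affine relations `R`. -/
theorem fPairs_of_certificate (R : List (Fin N → ℤ)) {M : ℕ} (hA : Function.Injective A)
    (hdim : ∀ c, ∃ i j, A i - A j = Pi.single c 1)
    (hb : ∀ l k, 0 ≤ slack A H b l k)
    (hR : ∀ r ∈ R, ∑ k, r k = 0 ∧ ∀ c, ∑ k, r k * A k c = 0)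
    (hdeg : ∀ i, ∃ j, FaceAdj A H b i j)
    (hadj : ∀ i j, i ≠ j → FaceAdj A H b i j ∨ ∃ r ∈ R, PosAt r i j ∨ PosAt (-r) i j)
    (hM : ∑ i, ∑ j, (if FaceAdj A H b i j then 1 else 0) = 2 * M) : (N, M) ∈ fPairs n := by
  have hinj : Function.Injective (realPt A) := fun i j h => hA <| by
    ext c
    exact Int.cast_injective (congrFun h c : (A i c : ℝ) = A j c)
  have hext (i : Fin N) : realPt A i ∈ (convexHull ℝ (range (realPt A))).extremePoints ℝ := by
    obtain ⟨j, hj⟩ := hdeg i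
    exact left_mem_extremePoints_of_isExtreme_segment (hj.isExtreme hb)
  have hiff (i j : Fin N) :
      (edgeGraph (convexHull ℝ (range (realPt A)))).Adj (realPt A i) (realPt A j) ↔
        FaceAdj A H b i j := by
    refine ⟨fun h => ?_, fun h => ⟨hinj.ne h.1, h.isExtreme hb⟩⟩
    have hij : i ≠ j := fun hij => h.1 (by rw [hij])
    refine (hadj i j hij).resolve_right ?_
    rintro ⟨r, hr, hr' | hr'⟩
    · exact hr'.not_isExtreme hinj hext (hR r hr).1 (hR r hr).2 hij h.2
    · refine hr'.not_isExtreme hinj hext ?_ (fun c => ?_) hij h.2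
      · simp [(hR r hr).1]
      · simp [(hR r hr).2 c]
  obtain ⟨h0, h1⟩ := f_vector_of_parametrization hinj rfl hext
  refine ⟨n, convexHull ℝ (range (realPt A)),
    ⟨⟨(finite_range (realPt A)).toFinset, by rw [Finite.coe_toFinset]⟩, ?_⟩,
    by simpa using h0, ?_⟩
  · suffices h : ⊤ ≤ vectorSpan ℝ (convexHull ℝ (range (realPt A))) by
      rw [adim, top_le_iff.1 h, finrank_top, Module.finrank_fin_fun]
    rw [← (Pi.basisFun ℝ (Fin n)).span_eq, Submodule.span_le]
    rintro _ ⟨c, rfl⟩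
    obtain ⟨i, j, hij⟩ := hdim c
    have : Pi.basisFun ℝ (Fin n) c = realPt A i - realPt A j := by
      ext c'
      have := congrFun hij c'
      simp only [Pi.sub_apply, Pi.single_apply] at this
      simp only [Pi.basisFun_apply, Pi.single_apply, Pi.sub_apply, realPt]
      exact_mod_cast this.symm
    rw [this]
    exact vsub_mem_vectorSpan ℝ (subset_convexHull ℝ _ ⟨i, rfl⟩) (subset_convexHull ℝ _ ⟨j, rfl⟩)
  · classical
    have h2 : 2 * f₁ (convexHull ℝ (range (realPt A))) = 2 * M := by
      rw [h1, ← hM]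
      exact Finset.sum_congr rfl fun i _ => Finset.sum_congr rfl fun j _ =>
        if_congr (hiff i j) rfl rfl
    simp only
    omega

end Certificate

/-- The vector with the given entries, zero elsewhere. -/
def sparse {N : ℕ} (l : List (Fin N × ℤ)) (k : Fin N) : ℤ :=
  (l.map fun p => if p.1 = k then p.2 else 0).sum

theorem fPairs_six_fourteen : (14, 46) ∈ fPairs 6 :=
  fPairs_of_certificate (A := ![
    ![1, 0, 0, 0, 0, 0], ![0, 1, 0, 0, 0, 0], ![0, 0, 1, 0, 0, 0], ![0, 0, 0, 1, 0, 0],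
    ![0, 0, 0, 0, 1, 0], ![0, 0, 0, 0, 0, 1], ![2, 0, 0, 0, 0, 0], ![0, 2, 0, 0, 0, 0],
    ![0, 0, 2, 0, 0, 0], ![0, 0, 0, 2, 0, 0], ![0, 0, 0, 0, 2, 0], ![0, 0, 0, 0, 0, 2],
    ![3, 1, 0, 0, 0, 0], ![1, 3, 0, 0, 0, 0]]) (H := ![
    ![1, 1, 1, 1, 1, 1], ![0, 0, 0, 0, 0, 1], ![0, 0, 0, 0, 1, 0], ![0, 0, 0, 1, 0, 0],
    ![0, 0, 1, 0, 0, 0], ![0, 1, 0, 0, 0, 0], ![1, 0, 0, 0, 0, 0], ![-1, 1, -1, -1, -1, -1],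
    ![1, -1, -1, -1, -1, -1], ![-1, -1, -2, -2, -2, -2]])
    (b := ![1, 0, 0, 0, 0, 0, 0, -2, -2, -4]) [
    sparse [(0, 2), (1, -2), (6, -1), (7, 1)], sparse [(0, 2), (2, -2), (6, -1), (8, 1)],
    sparse [(0, 2), (3, -2), (6, -1), (9, 1)], sparse [(0, 2), (4, -2), (6, -1), (10, 1)],
    sparse [(0, 2), (5, -2), (6, -1), (11, 1)], sparse [(0, 3), (1, -1), (6, -3), (12, 1)],
    sparse [(0, 5), (1, -3), (6, -3), (13, 1)], sparse [(1, 2), (2, -2), (7, -1), (8, 1)],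
    sparse [(1, 2), (3, -2), (7, -1), (9, 1)], sparse [(1, 2), (4, -2), (7, -1), (10, 1)],
    sparse [(1, 2), (5, -2), (7, -1), (11, 1)], sparse [(0, -3), (1, 5), (7, -3), (12, 1)],
    sparse [(0, -1), (1, 3), (7, -3), (13, 1)], sparse [(2, 2), (3, -2), (8, -1), (9, 1)],
    sparse [(2, 2), (4, -2), (8, -1), (10, 1)], sparse [(2, 2), (5, -2), (8, -1), (11, 1)],
    sparse [(0, -3), (1, -1), (2, 6), (8, -3), (12, 1)],
    sparse [(0, -1), (1, -3), (2, 6), (8, -3), (13, 1)],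
    sparse [(3, 2), (4, -2), (9, -1), (10, 1)], sparse [(3, 2), (5, -2), (9, -1), (11, 1)],
    sparse [(0, -3), (1, -1), (3, 6), (9, -3), (12, 1)],
    sparse [(0, -1), (1, -3), (3, 6), (9, -3), (13, 1)],
    sparse [(4, 2), (5, -2), (10, -1), (11, 1)],
    sparse [(0, -3), (1, -1), (4, 6), (10, -3), (12, 1)],
    sparse [(0, -1), (1, -3), (4, 6), (10, -3), (13, 1)],
    sparse [(0, -3), (1, -1), (5, 6), (11, -3), (12, 1)],
    sparse [(0, -1), (1, -3), (5, 6), (11, -3), (13, 1)],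
    sparse [(0, -4), (6, 5), (7, 1), (12, -2)], sparse [(0, -4), (6, 6), (12, -3), (13, 1)],
    sparse [(0, -4), (7, 6), (12, 3), (13, -5)]]
    (by decide +kernel) (by decide +kernel) (by decide +kernel) (by decide +kernel)
    (by decide +kernel) (by decide +kernel) (by decide +kernel)

theorem fPairs_six_sixteen : (16, 53) ∈ fPairs 6 :=
  fPairs_of_certificate (A := ![
    ![1, 0, 0, 0, 0, 0], ![0, 1, 0, 0, 0, 0], ![0, 0, 1, 0, 0, 0], ![0, 0, 0, 1, 0, 0],
    ![0, 0, 0, 0, 1, 0], ![0, 0, 0, 0, 0, 1], ![2, 0, 0, 0, 0, 0], ![0, 2, 0, 0, 0, 0],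
    ![0, 0, 2, 0, 0, 0], ![0, 0, 0, 2, 0, 0], ![0, 0, 0, 0, 2, 0], ![0, 0, 0, 0, 0, 2],
    ![3, 1, 0, 0, 0, 0], ![1, 3, 0, 0, 0, 0], ![1, 1, 2, 0, 0, 0], ![1, 1, 0, 2, 0, 0]]) (H := ![
    ![1, 1, 1, 1, 1, 1], ![0, 0, 0, 0, 0, 1], ![0, 0, 0, 0, 1, 0], ![0, 0, 0, 1, 0, 0],
    ![0, 0, 1, 0, 0, 0], ![0, 1, 0, 0, 0, 0], ![1, 0, 0, 0, 0, 0], ![-1, 1, -1, -1, -1, -1],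
    ![1, -1, -1, -1, -1, -1], ![-1, -1, -1, -1, -2, -2]])
    (b := ![1, 0, 0, 0, 0, 0, 0, -2, -2, -4]) [
    sparse [(0, 2), (1, -2), (6, -1), (7, 1)], sparse [(0, 2), (2, -2), (6, -1), (8, 1)],
    sparse [(0, 2), (3, -2), (6, -1), (9, 1)], sparse [(0, 2), (4, -2), (6, -1), (10, 1)],
    sparse [(0, 2), (5, -2), (6, -1), (11, 1)], sparse [(0, 3), (1, -1), (6, -3), (12, 1)],
    sparse [(0, 5), (1, -3), (6, -3), (13, 1)], sparse [(0, 2), (2, -2), (12, -1), (14, 1)],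
    sparse [(0, 2), (3, -2), (12, -1), (15, 1)], sparse [(1, 2), (2, -2), (7, -1), (8, 1)],
    sparse [(1, 2), (3, -2), (7, -1), (9, 1)], sparse [(1, 2), (4, -2), (7, -1), (10, 1)],
    sparse [(1, 2), (5, -2), (7, -1), (11, 1)], sparse [(0, -3), (1, 5), (7, -3), (12, 1)],
    sparse [(0, -1), (1, 3), (7, -3), (13, 1)], sparse [(1, 2), (2, -2), (13, -1), (14, 1)],
    sparse [(1, 2), (3, -2), (13, -1), (15, 1)], sparse [(2, 2), (3, -2), (8, -1), (9, 1)],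
    sparse [(2, 2), (4, -2), (8, -1), (10, 1)], sparse [(2, 2), (5, -2), (8, -1), (11, 1)],
    sparse [(0, -1), (1, -1), (2, 4), (8, -3), (14, 1)],
    sparse [(2, 2), (3, -2), (14, -1), (15, 1)], sparse [(3, 2), (4, -2), (9, -1), (10, 1)],
    sparse [(3, 2), (5, -2), (9, -1), (11, 1)],
    sparse [(0, -1), (1, -1), (3, 4), (9, -3), (15, 1)],
    sparse [(4, 2), (5, -2), (10, -1), (11, 1)],
    sparse [(0, -3), (1, -1), (4, 6), (10, -3), (12, 1)],
    sparse [(0, -1), (1, -3), (4, 6), (10, -3), (13, 1)],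
    sparse [(0, -1), (1, -1), (2, -2), (4, 6), (10, -3), (14, 1)],
    sparse [(0, -1), (1, -1), (3, -2), (4, 6), (10, -3), (15, 1)],
    sparse [(0, -3), (1, -1), (5, 6), (11, -3), (12, 1)],
    sparse [(0, -1), (1, -3), (5, 6), (11, -3), (13, 1)],
    sparse [(0, -1), (1, -1), (2, -2), (5, 6), (11, -3), (14, 1)],
    sparse [(0, -1), (1, -1), (3, -2), (5, 6), (11, -3), (15, 1)],
    sparse [(0, -4), (6, 5), (7, 1), (12, -2)], sparse [(0, -4), (6, 6), (12, -3), (13, 1)],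
    sparse [(6, 1), (8, -1), (12, -1), (14, 1)], sparse [(6, 1), (9, -1), (12, -1), (15, 1)],
    sparse [(0, -4), (7, 6), (12, 3), (13, -5)], sparse [(7, 1), (8, -1), (13, -1), (14, 1)],
    sparse [(7, 1), (9, -1), (13, -1), (15, 1)], sparse [(8, 1), (9, -1), (14, -1), (15, 1)]]
    (by decide +kernel) (by decide +kernel) (by decide +kernel) (by decide +kernel)
    (by decide +kernel) (by decide +kernel) (by decide +kernel)

theorem fPairs_six_eighteen : (18, 60) ∈ fPairs 6 :=
  fPairs_of_certificate (A := ![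
    ![0, 0, 0, 0, 0, 0], ![0, 0, 1, 0, 0, 0], ![0, 0, 0, 1, 0, 0], ![0, 0, 0, 0, 1, 0],
    ![0, 0, 0, 0, 0, 1], ![0, 0, 1, 1, 1, 1], ![1, 0, 0, 0, 0, 0], ![1, 0, 1, 0, 0, 0],
    ![1, 0, 0, 1, 0, 0], ![1, 0, 0, 0, 1, 0], ![1, 0, 0, 0, 0, 1], ![1, 0, 1, 1, 1, 1],
    ![0, 1, 0, 0, 0, 0], ![0, 1, 1, 0, 0, 0], ![0, 1, 0, 1, 0, 0], ![0, 1, 0, 0, 1, 0],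
    ![0, 1, 0, 0, 0, 1], ![0, 1, 1, 1, 1, 1]]) (H := ![
    ![0, 1, 0, 0, 0, 0], ![1, 0, 0, 0, 0, 0], ![0, 0, 0, 0, 0, 1], ![0, 0, 0, 0, 1, 0],
    ![0, 0, 0, 1, 0, 0], ![0, 0, 1, 0, 0, 0], ![0, 0, -1, -1, -1, 2], ![0, 0, -1, -1, 2, -1],
    ![0, 0, -1, 2, -1, -1], ![0, 0, 2, -1, -1, -1], ![-1, -1, 0, 0, 0, 0]])
    (b := ![0, 0, 0, 0, 0, 0, -1, -1, -1, -1, -1]) [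
    sparse [(0, 3), (1, -1), (2, -1), (3, -1), (4, -1), (5, 1)],
    sparse [(0, 1), (1, -1), (6, -1), (7, 1)], sparse [(0, 1), (2, -1), (6, -1), (8, 1)],
    sparse [(0, 1), (3, -1), (6, -1), (9, 1)], sparse [(0, 1), (4, -1), (6, -1), (10, 1)],
    sparse [(0, 1), (5, -1), (6, -1), (11, 1)], sparse [(0, 1), (1, -1), (12, -1), (13, 1)],
    sparse [(0, 1), (2, -1), (12, -1), (14, 1)], sparse [(0, 1), (3, -1), (12, -1), (15, 1)],
    sparse [(0, 1), (4, -1), (12, -1), (16, 1)], sparse [(0, 1), (5, -1), (12, -1), (17, 1)],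
    sparse [(1, 1), (2, -1), (7, -1), (8, 1)], sparse [(1, 1), (3, -1), (7, -1), (9, 1)],
    sparse [(1, 1), (4, -1), (7, -1), (10, 1)], sparse [(1, 1), (5, -1), (7, -1), (11, 1)],
    sparse [(1, 1), (2, -1), (13, -1), (14, 1)], sparse [(1, 1), (3, -1), (13, -1), (15, 1)],
    sparse [(1, 1), (4, -1), (13, -1), (16, 1)], sparse [(1, 1), (5, -1), (13, -1), (17, 1)],
    sparse [(2, 1), (3, -1), (8, -1), (9, 1)], sparse [(2, 1), (4, -1), (8, -1), (10, 1)],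
    sparse [(2, 1), (5, -1), (8, -1), (11, 1)], sparse [(2, 1), (3, -1), (14, -1), (15, 1)],
    sparse [(2, 1), (4, -1), (14, -1), (16, 1)], sparse [(2, 1), (5, -1), (14, -1), (17, 1)],
    sparse [(3, 1), (4, -1), (9, -1), (10, 1)], sparse [(3, 1), (5, -1), (9, -1), (11, 1)],
    sparse [(3, 1), (4, -1), (15, -1), (16, 1)], sparse [(3, 1), (5, -1), (15, -1), (17, 1)],
    sparse [(4, 1), (5, -1), (10, -1), (11, 1)], sparse [(4, 1), (5, -1), (16, -1), (17, 1)],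
    sparse [(6, 3), (7, -1), (8, -1), (9, -1), (10, -1), (11, 1)],
    sparse [(6, 1), (7, -1), (12, -1), (13, 1)], sparse [(6, 1), (8, -1), (12, -1), (14, 1)],
    sparse [(6, 1), (9, -1), (12, -1), (15, 1)], sparse [(6, 1), (10, -1), (12, -1), (16, 1)],
    sparse [(6, 1), (11, -1), (12, -1), (17, 1)], sparse [(7, 1), (8, -1), (13, -1), (14, 1)],
    sparse [(7, 1), (9, -1), (13, -1), (15, 1)], sparse [(7, 1), (10, -1), (13, -1), (16, 1)],
    sparse [(7, 1), (11, -1), (13, -1), (17, 1)], sparse [(8, 1), (9, -1), (14, -1), (15, 1)],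
    sparse [(8, 1), (10, -1), (14, -1), (16, 1)], sparse [(8, 1), (11, -1), (14, -1), (17, 1)],
    sparse [(9, 1), (10, -1), (15, -1), (16, 1)], sparse [(9, 1), (11, -1), (15, -1), (17, 1)],
    sparse [(10, 1), (11, -1), (16, -1), (17, 1)],
    sparse [(12, 3), (13, -1), (14, -1), (15, -1), (16, -1), (17, 1)]]
    (by decide +kernel) (by decide +kernel) (by decide +kernel) (by decide +kernel)
    (by decide +kernel) (by decide +kernel) (by decide +kernel)
/-- For odd `f0 ≥ 12`, `(f0+1, ⌊(7/2)·f0 + 1⌋) ∈ E^6`; moreover if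
`(f0+1, ⌊(7/2)·f0 + 1⌋) ∈ E^6` then `(f0+7, ⌊(7/2)·(f0+6) + 1⌋) ∈ E^6`. -/
theorem stmt6 :
    (∀ f0 : ℕ, 12 ≤ f0 → Odd f0 → (f0 + 1, 7 * f0 / 2 + 1) ∈ fPairs 6) ∧
    (∀ f0 : ℕ, 7 ≤ f0 → (f0 + 1, 7 * f0 / 2 + 1) ∈ fPairs 6 →
      (f0 + 7, 7 * (f0 + 6) / 2 + 1) ∈ fPairs 6) := by
  refine ⟨fun f0 h hodd => ?_, fun f0 _ h => fPairs_six_add_six h⟩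
  induction f0 using Nat.strong_induction_on with
  | _ f0 ih =>
    obtain rfl | rfl | rfl | h18 : f0 = 13 ∨ f0 = 15 ∨ f0 = 17 ∨ 18 ≤ f0 := by
      obtain ⟨k, rfl⟩ := hodd
      omega
    · exact fPairs_six_fourteen
    · exact fPairs_six_sixteen
    · exact fPairs_six_eighteen
    · obtain ⟨g, rfl⟩ : ∃ g, f0 = g + 6 := ⟨f0 - 6, by omega⟩
      exact fPairs_six_add_six (ih g (by omega) (by omega) (by grind))
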